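/- arXiv:2007.11518 — 2 statements merged into one kernel-verified Lean document; each statement's English description precedes it below -/
import Mathlib

section
/- Let A be a 2×2 integer matrix with determinant 1 and trace > 2, and let ℰ ⊆ 𝕋² be a finite f_A-invariant set. Then there exist two disjoint periodic orbits γ₊ and γ₋ of f_A, both disjoint from ℰ, such that there exist a positive γ₊-rectangle and a negative γ₊-rectangle each disjoint from the lift of γ₋ ∪ ℰ, and there exist a positive γ₋-rectangle and a negative γ₋-rectangle each disjoint from the lift of γ₊ ∪ ℰ. -/
/- Common setup: following the paper, we identify each subset of the torus
`𝕋² = ℝ²/ℤ²` with its (`ℤ²`-saturated) lift to `ℝ²`. -/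

open Matrix Set
open scoped Pointwise

namespace Paper

/-- Points of the plane ℝ². -/
abbrev V : Type := Fin 2 → ℝ

/-- The integer lattice ℤ² ⊆ ℝ². -/
def lattice : Set V := Set.range fun m : Fin 2 → ℤ => fun i => (m i : ℝ)

/-- The linear action of an integer matrix on ℝ². -/
def actR (A : Matrix (Fin 2) (Fin 2) ℤ) (v : V) : V :=
  (A.map (Int.cast : ℤ → ℝ)).mulVec v

/-- `E ⊆ ℝ²` is the lift of a finite subset of the torus. -/
def IsTorusFinite (E : Set V) : Prop := ∃ F : Set V, F.Finite ∧ E = F + lattice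

/-- `E` is the lift of an `f_A`-invariant subset of the torus. -/
def IsInvariant (A : Matrix (Fin 2) (Fin 2) ℤ) (E : Set V) : Prop := actR A '' E = E

/-- `E` is the lift of a periodic orbit of `f_A`. -/
def IsPeriodicOrbit (A : Matrix (Fin 2) (Fin 2) ℤ) (E : Set V) : Prop :=
  ∃ x : V, ∃ p : ℕ, 0 < p ∧ (actR A)^[p] x - x ∈ lattice ∧
    E = {v | ∃ i : ℕ, v - (actR A)^[i] x ∈ lattice}

/-- A rectangle `R(p; s, u)`, recorded via its basepoint `p` and its side
lengths `s, u > 0` (in the directions of the fixed eigenvectors `v^s, v^u`). -/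
structure Rect where
  p : V
  s : ℝ
  u : ℝ
  s_pos : 0 < s
  u_pos : 0 < u

namespace Rect

/-- The set of points of the rectangle `R(p;s,u)`. -/
def carrier (vs vu : V) (R : Rect) : Set V :=
  {q | ∃ a b : ℝ, 0 ≤ a ∧ a ≤ R.s ∧ 0 ≤ b ∧ b ≤ R.u ∧ q = R.p + a • vs + b • vu}

/-- Endpoint of the increasing diagonal (whose origin is `R.p`). -/
def incEnd (vs vu : V) (R : Rect) : V := R.p + R.s • vs + R.u • vu

/-- Origin of the decreasing diagonal. -/
def decOrigin (vs : V) (R : Rect) : V := R.p + R.s • vs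

/-- Endpoint of the decreasing diagonal. -/
def decEnd (vu : V) (R : Rect) : V := R.p + R.u • vu

/-- `R` is a positive `E`-rectangle. -/
def IsPos (vs vu : V) (E : Set V) (R : Rect) : Prop :=
  R.p ∈ E ∧ R.incEnd vs vu ∈ E

/-- `R` is a negative `E`-rectangle. -/
def IsNeg (vs vu : V) (E : Set V) (R : Rect) : Prop :=
  R.decOrigin vs ∈ E ∧ R.decEnd vu ∈ E

/-- `R` is a primitive positive `E`-rectangle. -/
def IsPrimPos (vs vu : V) (E : Set V) (R : Rect) : Prop :=
  R.IsPos vs vu E ∧ R.carrier vs vu ∩ E = {R.p, R.incEnd vs vu}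

/-- `R` is a primitive negative `E`-rectangle. -/
def IsPrimNeg (vs vu : V) (E : Set V) (R : Rect) : Prop :=
  R.IsNeg vs vu E ∧ R.carrier vs vu ∩ E = {R.decOrigin vs, R.decEnd vu}

/-- Bottom stable side of a rectangle. -/
def botSide (vs : V) (R : Rect) : Set V :=
  {q | ∃ a : ℝ, 0 ≤ a ∧ a ≤ R.s ∧ q = R.p + a • vs}

/-- Top stable side of a rectangle. -/
def topSide (vs vu : V) (R : Rect) : Set V :=
  {q | ∃ a : ℝ, 0 ≤ a ∧ a ≤ R.s ∧ q = R.p + a • vs + R.u • vu}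

/-- Left unstable side of a rectangle. -/
def leftSide (vu : V) (R : Rect) : Set V :=
  {q | ∃ b : ℝ, 0 ≤ b ∧ b ≤ R.u ∧ q = R.p + b • vu}

/-- Interior of a rectangle. -/
def interior (vs vu : V) (R : Rect) : Set V :=
  {q | ∃ a b : ℝ, 0 < a ∧ a < R.s ∧ 0 < b ∧ b < R.u ∧ q = R.p + a • vs + b • vu}

end Rect

/-- The (closed) quadrant `C₊₊(x)`. -/
def quadPP (vs vu x : V) : Set V :=
  {q | ∃ a b : ℝ, 0 ≤ a ∧ 0 ≤ b ∧ q = x + a • vs + b • vu}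

/-- `D` is a right horizontal subrectangle of `R`. -/
def IsRightHorizSub (vs : V) (D R : Rect) : Prop :=
  D.s ≤ R.s ∧ D.u = R.u ∧ D.p = R.p + (R.s - D.s) • vs

/-- A positive `X`-string with origin `x`: a sequence of positive `X`-rectangles,
the first one having `x` as origin of its increasing diagonal, consecutive ones
meeting exactly at one point which is the endpoint of the increasing diagonal of
the former and the origin of the increasing diagonal of the latter. -/
def IsPosString (vs vu : V) (X : Set V) (x : V) (R : ℕ → Rect) : Prop :=
  (∀ i, (R i).IsPos vs vu X) ∧ (R 0).p = x ∧
    ∀ i, (R i).carrier vs vu ∩ (R (i + 1)).carrier vs vu = {(R i).incEnd vs vu} ∧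
      (R (i + 1)).p = (R i).incEnd vs vu

/-- A positive `X`-staircase with origin `x`. -/
def IsPosStaircase (vs vu : V) (X : Set V) (x : V) (R : ℕ → Rect) : Prop :=
  (∀ i, (R i).carrier vs vu ⊆ quadPP vs vu x) ∧
    ∃ Del : ℕ → Rect, IsPosString vs vu X x Del ∧ R 0 = Del 0 ∧
      (∀ i, 1 ≤ i → IsRightHorizSub vs (Del i) (R i)) ∧
      (∀ i, (R i).topSide vs vu ⊆ (R (i + 1)).botSide vs) ∧
      ∃ C : ℝ, ∀ i, (Del (i + 1)).s / (Del i).s ≤ C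

/-- Stable side lengths of the primitive positive `(X, x)`-rectangles. -/
def baseLengths (vs vu : V) (X : Set V) (x : V) : Set ℝ :=
  {s | ∃ R : Rect, R.IsPrimPos vs vu X ∧ R.p = x ∧ R.s = s}

/-- The Euclidean norm of a point of ℝ². -/
noncomputable def euclNorm (v : V) : ℝ := Real.sqrt ((v 0) ^ 2 + (v 1) ^ 2)

/-- `Y` is the lift of an `ε`-dense subset of the torus, for the metric on the
torus induced by the Euclidean metric of ℝ². -/
def EDense (ε : ℝ) (Y : Set V) : Prop := ∀ v : V, ∃ y ∈ Y, euclNorm (v - y) ≤ ε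

/-- The lift of `{(0,1/2), (1/2,0), (1/2,1/2)}`, i.e. the set
`{(0,1/2), (1/2,0), (1/2,1/2)} + ℤ²`. -/
def halfPoints : Set V :=
  {v : V | ∃ w ∈ ({![0, 1/2], ![1/2, 0], ![1/2, 1/2]} : Set V), v - w ∈ lattice}

/-- The lift of the point `(1/2,1/2)` of the torus, i.e. `(1/2,1/2) + ℤ²`. -/
def halfCenter : Set V := {v : V | v - ![1/2, 1/2] ∈ lattice}

/-- The lattice ℤ² as an additive subgroup. -/
def latticeGroup : AddSubgroup V where
  carrier := lattice
  zero_mem' := ⟨0, by ext i; simp⟩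
  add_mem' := by
    rintro _ _ ⟨m, rfl⟩ ⟨n, rfl⟩
    exact ⟨m + n, by ext i; simp⟩
  neg_mem' := by
    rintro _ ⟨m, rfl⟩
    exact ⟨-m, by ext i; simp⟩

/-- The linear map underlying `actR A`. -/
noncomputable def actLin (A : Matrix (Fin 2) (Fin 2) ℤ) : V →ₗ[ℝ] V :=
  (A.map (Int.cast : ℤ → ℝ)).mulVecLin

lemma actR_eq_actLin (A : Matrix (Fin 2) (Fin 2) ℤ) : actR A = actLin A := rfl

lemma iterate_actR (A : Matrix (Fin 2) (Fin 2) ℤ) (i : ℕ) :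
    (actR A)^[i] = ((actLin A) ^ i : V →ₗ[ℝ] V) := by
  rw [actR_eq_actLin, Module.End.coe_pow]

lemma actR_mem_lattice (A : Matrix (Fin 2) (Fin 2) ℤ) {v : V} (hv : v ∈ latticeGroup) :
    actR A v ∈ latticeGroup := by
  obtain ⟨m, rfl⟩ := hv
  refine ⟨A.mulVec m, ?_⟩
  ext i
  simp [actR, Matrix.mulVec, dotProduct]

lemma iterate_actR_mem_lattice (A : Matrix (Fin 2) (Fin 2) ℤ) {v : V} (hv : v ∈ latticeGroup)
    (i : ℕ) : (actR A)^[i] v ∈ latticeGroup := by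
  induction i with
  | zero => simpa using hv
  | succ i ih =>
    rw [Function.iterate_succ_apply']
    exact actR_mem_lattice A ih

lemma isClosed_lattice : IsClosed lattice := by
  have h : lattice = Set.pi Set.univ fun _ : Fin 2 => Set.range (Int.cast : ℤ → ℝ) := by
    ext v
    constructor
    · rintro ⟨m, rfl⟩ i -
      exact ⟨m i, rfl⟩
    · intro hv
      choose m hm using fun i => hv i (Set.mem_univ i)
      exact ⟨m, funext hm⟩
  rw [h]
  exact isClosed_set_pi fun _ _ => Int.isClosedEmbedding_coe_real.isClosed_range

lemma IsTorusFinite.isClosed {E : Set V} (hE : IsTorusFinite E) : IsClosed E := by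
  obtain ⟨F, hF, rfl⟩ := hE
  exact isClosed_lattice.add_left_of_isCompact hF.isCompact

lemma IsTorusFinite.union {E E' : Set V} (hE : IsTorusFinite E) (hE' : IsTorusFinite E') :
    IsTorusFinite (E ∪ E') := by
  obtain ⟨F, hF, rfl⟩ := hE
  obtain ⟨F', hF', rfl⟩ := hE'
  exact ⟨F ∪ F', hF.union hF', Set.union_add.symm⟩

lemma IsTorusFinite.neg {E : Set V} (hE : IsTorusFinite E) : IsTorusFinite (-E) := by
  obtain ⟨F, hF, rfl⟩ := hE
  refine ⟨-F, hF.neg, ?_⟩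
  rw [neg_add]
  congr 1
  ext v
  exact latticeGroup.neg_mem_iff (x := v)

lemma IsTorusFinite.mem_of_sub_mem {E : Set V} (hE : IsTorusFinite E) {v w : V} (hw : w ∈ E)
    (h : v - w ∈ latticeGroup) : v ∈ E := by
  obtain ⟨F, -, rfl⟩ := hE
  obtain ⟨f, hf, l, hl, rfl⟩ := hw
  refine ⟨f, hf, v - f, ?_, by simp⟩
  have := latticeGroup.add_mem h (show l ∈ latticeGroup from hl)
  rwa [show v - (f + l) + l = v - f by abel] at this

/-- A periodic orbit meeting a forward invariant `ℤ²`-periodic set is contained in it. -/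
lemma IsPeriodicOrbit.subset_of_mem {A : Matrix (Fin 2) (Fin 2) ℤ} {X S : Set V}
    (hX : IsPeriodicOrbit A X) (hS : ∀ v ∈ S, actR A v ∈ S)
    (hSl : ∀ v w, w ∈ S → v - w ∈ latticeGroup → v ∈ S) {v : V} (hvX : v ∈ X) (hvS : v ∈ S) :
    X ⊆ S := by
  obtain ⟨x, p, hp, hper, rfl⟩ := hX
  obtain ⟨i, hi⟩ := hvX
  have hiter : ∀ k, (actR A)^[i + k] x ∈ S := by
    intro k
    induction k with
    | zero =>
      refine hSl _ _ hvS ?_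
      rw [← neg_sub]
      exact latticeGroup.neg_mem hi
    | succ k ih =>
      rw [← add_assoc, Function.iterate_succ_apply']
      exact hS _ ih
  have hshift : ∀ j k, (actR A)^[j + p * k] x - (actR A)^[j] x ∈ latticeGroup := by
    intro j k
    induction k with
    | zero => simp
    | succ k ih =>
      have h := latticeGroup.add_mem (iterate_actR_mem_lattice A
        (show (actR A)^[p] x - x ∈ latticeGroup from hper) (j + p * k)) ih
      rw [iterate_actR A (j + p * k), map_sub, ← iterate_actR,
        ← Function.iterate_add_apply] at h
      rw [show j + p * (k + 1) = j + p * k + p by ring]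
      simpa using h
  rintro w ⟨j, hj⟩
  obtain ⟨k, hk⟩ : ∃ k, j + p * i = i + k :=
    ⟨j + p * i - i, by have := Nat.le_mul_of_pos_left i hp; omega⟩
  refine hSl _ _ (hiter k) ?_
  rw [← hk]
  have := latticeGroup.sub_mem (show w - (actR A)^[j] x ∈ latticeGroup from hj) (hshift j i)
  rwa [show w - (actR A)^[j] x - ((actR A)^[j + p * i] x - (actR A)^[j] x)
    = w - (actR A)^[j + p * i] x by abel] at this

lemma IsPeriodicOrbit.actR_mem {A : Matrix (Fin 2) (Fin 2) ℤ} {X : Set V}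
    (hX : IsPeriodicOrbit A X) {v : V} (hv : v ∈ X) : actR A v ∈ X := by
  obtain ⟨x, p, hp, hper, rfl⟩ := hX
  obtain ⟨i, hi⟩ := hv
  refine ⟨i + 1, ?_⟩
  have := actR_mem_lattice A (show v - (actR A)^[i] x ∈ latticeGroup from hi)
  rwa [show actR A (v - (actR A)^[i] x) = actR A v - (actR A)^[i + 1] x by
    rw [Function.iterate_succ_apply']; exact map_sub (actLin A) _ _] at this

lemma IsPeriodicOrbit.mem_of_sub_mem {A : Matrix (Fin 2) (Fin 2) ℤ} {X : Set V}
    (hX : IsPeriodicOrbit A X) {v w : V} (hw : w ∈ X) (h : v - w ∈ latticeGroup) : v ∈ X := by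
  obtain ⟨x, p, hp, hper, rfl⟩ := hX
  obtain ⟨i, hi⟩ := hw
  refine ⟨i, ?_⟩
  have := latticeGroup.add_mem h (show w - (actR A)^[i] x ∈ latticeGroup from hi)
  rwa [sub_add_sub_cancel] at this

lemma IsPeriodicOrbit.neg {A : Matrix (Fin 2) (Fin 2) ℤ} {X : Set V}
    (hX : IsPeriodicOrbit A X) : IsPeriodicOrbit A (-X) := by
  obtain ⟨x, p, hp, hper, rfl⟩ := hX
  refine ⟨-x, p, hp, ?_, ?_⟩
  · rw [iterate_actR, map_neg, ← neg_sub', ← iterate_actR]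
    exact latticeGroup.neg_mem hper
  · ext v
    simp only [Set.mem_neg, Set.mem_ofPred_eq, iterate_actR, map_neg]
    refine exists_congr fun i => ?_
    rw [show -v - (actLin A ^ i) x = -(v - -(actLin A ^ i) x) by abel]
    exact latticeGroup.neg_mem_iff

lemma actR_neg (A : Matrix (Fin 2) (Fin 2) ℤ) (v : V) : actR A (-v) = -actR A v :=
  map_neg (actLin A) v

namespace Rect

/-- The image of a rectangle under `v ↦ -v`. -/
def reflect (vs vu : V) (R : Rect) : Rect :=
  ⟨-R.incEnd vs vu, R.s, R.u, R.s_pos, R.u_pos⟩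

lemma IsPos.reflect {vs vu : V} {X : Set V} {R : Rect} (h : R.IsPos vs vu X) :
    (R.reflect vs vu).IsPos vs vu (-X) := by
  refine ⟨by simpa [Rect.reflect] using h.2, ?_⟩
  have : (R.reflect vs vu).incEnd vs vu = -R.p := by
    simp only [Rect.reflect, incEnd]; abel
  rw [this]
  simpa using h.1

lemma IsNeg.reflect {vs vu : V} {X : Set V} {R : Rect} (h : R.IsNeg vs vu X) :
    (R.reflect vs vu).IsNeg vs vu (-X) := by
  have h1 : (R.reflect vs vu).decOrigin vs = -R.decEnd vu := by
    simp only [Rect.reflect, incEnd, decOrigin, decEnd]; abel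
  have h2 : (R.reflect vs vu).decEnd vu = -R.decOrigin vs := by
    simp only [Rect.reflect, incEnd, decOrigin, decEnd]; abel
  refine ⟨?_, ?_⟩
  · rw [h1]; simpa using h.2
  · rw [h2]; simpa using h.1

lemma neg_mem_carrier_of_mem_reflect {vs vu : V} {R : Rect} {q : V}
    (h : q ∈ (R.reflect vs vu).carrier vs vu) : -q ∈ R.carrier vs vu := by
  obtain ⟨a, b, ha, ha', hb, hb', rfl⟩ := h
  simp only [Rect.reflect] at ha' hb'
  refine ⟨R.s - a, R.u - b, by linarith, by linarith, by linarith, by linarith, ?_⟩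
  simp only [Rect.reflect, incEnd]
  module

lemma disjoint_reflect {vs vu : V} {R : Rect} {S : Set V}
    (h : Disjoint (R.carrier vs vu) S) : Disjoint ((R.reflect vs vu).carrier vs vu) (-S) := by
  rw [Set.disjoint_left] at h ⊢
  exact fun q hq => h (neg_mem_carrier_of_mem_reflect hq)

lemma p_mem_carrier (vs vu : V) (R : Rect) : R.p ∈ R.carrier vs vu :=
  ⟨0, 0, le_rfl, R.s_pos.le, le_rfl, R.u_pos.le, by simp⟩

/-- Two points differing by vectors of the same orientation in both eigendirections span a
positive rectangle. -/
lemma exists_isPos {vs vu : V} {X : Set V} {a₁ b₁ a₂ b₂ : ℝ}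
    (h₁ : a₁ • vs + b₁ • vu ∈ X) (h₂ : a₂ • vs + b₂ • vu ∈ X)
    (h : 0 < (a₂ - a₁) * (b₂ - b₁)) :
    ∃ R : Rect, R.IsPos vs vu X ∧ ∀ q ∈ R.carrier vs vu,
      ∃ a ∈ Set.uIcc a₁ a₂, ∃ b ∈ Set.uIcc b₁ b₂, q = a • vs + b • vu := by
  wlog ha : a₁ < a₂ generalizing a₁ b₁ a₂ b₂
  · obtain ⟨R, hR, hq⟩ := this h₂ h₁ (by linarith)
      (lt_of_le_of_ne (not_lt.1 ha) (by rintro rfl; simp at h))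
    refine ⟨R, hR, ?_⟩
    rwa [Set.uIcc_comm a₁, Set.uIcc_comm b₁]
  have hb : b₁ < b₂ := sub_pos.1 (pos_of_mul_pos_right h (sub_pos.2 ha).le)
  refine ⟨⟨a₁ • vs + b₁ • vu, a₂ - a₁, b₂ - b₁, sub_pos.2 ha, sub_pos.2 hb⟩, ⟨h₁, ?_⟩, ?_⟩
  · convert h₂ using 1
    simp only [incEnd]
    module
  · rintro q ⟨a, b, ha1, ha2, hb1, hb2, rfl⟩
    simp only at ha2 hb2
    rw [Set.uIcc_of_le ha.le, Set.uIcc_of_le hb.le]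
    exact ⟨a₁ + a, ⟨by linarith, by linarith⟩, b₁ + b, ⟨by linarith, by linarith⟩, by module⟩

/-- Two points differing by vectors of opposite orientations in the eigendirections span a
negative rectangle. -/
lemma exists_isNeg {vs vu : V} {X : Set V} {a₁ b₁ a₂ b₂ : ℝ}
    (h₁ : a₁ • vs + b₁ • vu ∈ X) (h₂ : a₂ • vs + b₂ • vu ∈ X)
    (h : (a₂ - a₁) * (b₂ - b₁) < 0) :
    ∃ R : Rect, R.IsNeg vs vu X ∧ ∀ q ∈ R.carrier vs vu,
      ∃ a ∈ Set.uIcc a₁ a₂, ∃ b ∈ Set.uIcc b₁ b₂, q = a • vs + b • vu := by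
  wlog ha : a₁ < a₂ generalizing a₁ b₁ a₂ b₂
  · obtain ⟨R, hR, hq⟩ := this h₂ h₁ (by linarith)
      (lt_of_le_of_ne (not_lt.1 ha) (by rintro rfl; simp at h))
    refine ⟨R, hR, ?_⟩
    rwa [Set.uIcc_comm a₁, Set.uIcc_comm b₁]
  have hb : b₂ < b₁ := by
    by_contra hb
    have := mul_nonneg (sub_pos.2 ha).le (sub_nonneg.2 (not_lt.1 hb))
    linarith
  refine ⟨⟨a₁ • vs + b₂ • vu, a₂ - a₁, b₁ - b₂, sub_pos.2 ha, sub_pos.2 hb⟩, ⟨?_, ?_⟩, ?_⟩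
  · convert h₂ using 1
    simp only [decOrigin]
    module
  · convert h₁ using 1
    simp only [decEnd]
    module
  · rintro q ⟨a, b, ha1, ha2, hb1, hb2, rfl⟩
    simp only at ha2 hb2
    rw [Set.uIcc_of_le ha.le, Set.uIcc_of_ge hb.le]
    exact ⟨a₁ + a, ⟨by linarith, by linarith⟩, b₂ + b, ⟨by linarith, by linarith⟩, by module⟩

end Rect

/-- `cs` and `cu` are the coordinate functionals of the eigenbasis `(vs, vu)` of `A`. -/
structure EigenFrame (A : Matrix (Fin 2) (Fin 2) ℤ) (lam : ℝ) (vs vu : V)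
    (cs cu : V →ₗ[ℝ] ℝ) : Prop where
  one_lt : 1 < lam
  actR_vs : actR A vs = lam⁻¹ • vs
  actR_vu : actR A vu = lam • vu
  decomp : ∀ v, v = cs v • vs + cu v • vu
  cs_vs : cs vs = 1
  cs_vu : cs vu = 0
  cu_vs : cu vs = 0
  cu_vu : cu vu = 1

/-- Eigenvectors for distinct eigenvalues are not parallel. -/
lemma cross_ne_zero {A : Matrix (Fin 2) (Fin 2) ℤ} {lam : ℝ} (hlam : 1 < lam) {vs vu : V}
    (hvs : vs ≠ 0) (hvu : vu ≠ 0) (hAs : actR A vs = lam⁻¹ • vs) (hAu : actR A vu = lam • vu) :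
    vs 0 * vu 1 - vs 1 * vu 0 ≠ 0 := by
  intro h
  obtain ⟨i, hi⟩ := Function.ne_iff.1 hvs
  have hpar : vs i • vu = vu i • vs := by
    ext j
    fin_cases i <;> fin_cases j <;> simp <;> linarith
  have h1 : vs i • lam • vu = vs i • lam⁻¹ • vu := by
    have := congrArg (actLin A) hpar
    rw [map_smul, map_smul, ← actR_eq_actLin, hAs, hAu] at this
    rw [this, smul_comm, ← hpar, smul_comm]
  have h2 : lam • vu = lam⁻¹ • vu := smul_right_injective V hi h1
  have h3 : lam = lam⁻¹ := smul_left_injective ℝ hvu h2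
  have := inv_lt_one_of_one_lt₀ hlam
  linarith

lemma exists_eigenFrame {A : Matrix (Fin 2) (Fin 2) ℤ} {lam : ℝ} (hlam : 1 < lam) {vs vu : V}
    (hvs : vs ≠ 0) (hvu : vu ≠ 0) (hAs : actR A vs = lam⁻¹ • vs) (hAu : actR A vu = lam • vu) :
    ∃ cs cu : V →ₗ[ℝ] ℝ, EigenFrame A lam vs vu cs cu := by
  have h := cross_ne_zero hlam hvs hvu hAs hAu
  refine ⟨(vs 0 * vu 1 - vs 1 * vu 0)⁻¹ • (vu 1 • LinearMap.proj 0 - vu 0 • LinearMap.proj 1),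
    (vs 0 * vu 1 - vs 1 * vu 0)⁻¹ • (vs 0 • LinearMap.proj 1 - vs 1 • LinearMap.proj 0),
    hlam, hAs, hAu, fun v => ?_, ?_, ?_, ?_, ?_⟩
  · ext i
    fin_cases i <;> simp <;> field_simp <;> ring
  · simp [mul_comm (vu 1), mul_comm (vu 0), h]
  · simp [mul_comm]
  · simp [mul_comm]
  · simp [h]

/-- The integral quadratic form `n ↦ det (n, A n)`. -/
def crossForm (A : Matrix (Fin 2) (Fin 2) ℤ) (n : Fin 2 → ℤ) : ℤ :=
  n 0 * A.mulVec n 1 - n 1 * A.mulVec n 0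

lemma crossForm_ne_zero {A : Matrix (Fin 2) (Fin 2) ℤ} (hdet : A.det = 1) (htr : 2 < A.trace)
    {n : Fin 2 → ℤ} (hn : n ≠ 0) : crossForm A n ≠ 0 := by
  intro h
  rw [Matrix.det_fin_two] at hdet
  rw [Matrix.trace_fin_two] at htr
  simp only [crossForm, Matrix.mulVec, dotProduct, Fin.sum_univ_two] at h
  generalize A 0 0 = a, A 0 1 = b, A 1 0 = c, A 1 1 = d at *
  have hsq : (2 * c * n 0 + (d - a) * n 1) ^ 2 = ((a + d) ^ 2 - 4) * n 1 ^ 2 := by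
    linear_combination 4 * c * h - 4 * n 1 ^ 2 * hdet
  have hD : ∀ r : ℤ, r ^ 2 ≠ (a + d) ^ 2 - 4 := by
    intro r hr
    have h1 : |r| < a + d := abs_lt_of_sq_lt_sq (by linarith) (by linarith)
    have h2 : a + d - 1 < |r| := lt_of_pow_lt_pow_left₀ 2 (abs_nonneg r) (by
      rw [sq_abs, hr]; nlinarith)
    omega
  by_cases h1 : n 1 = 0
  · have hc : c ≠ 0 := by
      rintro rfl
      exact hD (a - d) (by linear_combination -4 * hdet)
    have h0 : n 0 = 0 := by simpa [h1, hc] using h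
    exact hn (by ext i; fin_cases i <;> simp [h0, h1])
  · have hdvd : n 1 ^ 2 ∣ (2 * c * n 0 + (d - a) * n 1) ^ 2 := ⟨_, by rw [hsq, mul_comm]⟩
    obtain ⟨r, hr⟩ := (Int.pow_dvd_pow_iff two_ne_zero).1 hdvd
    rw [hr] at hsq
    exact hD r (mul_right_cancel₀ (pow_ne_zero 2 h1) (by linear_combination hsq))

namespace EigenFrame

variable {A : Matrix (Fin 2) (Fin 2) ℤ} {lam : ℝ} {vs vu : V} {cs cu : V →ₗ[ℝ] ℝ}

lemma cs_coord (h : EigenFrame A lam vs vu cs cu) (a b : ℝ) : cs (a • vs + b • vu) = a := by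
  simp [h.cs_vs, h.cs_vu]

lemma cu_coord (h : EigenFrame A lam vs vu cs cu) (a b : ℝ) : cu (a • vs + b • vu) = b := by
  simp [h.cu_vs, h.cu_vu]

lemma actR_coord (h : EigenFrame A lam vs vu cs cu) (a b : ℝ) :
    actR A (a • vs + b • vu) = (lam⁻¹ * a) • vs + (lam * b) • vu := by
  rw [actR_eq_actLin, map_add, map_smul, map_smul, ← actR_eq_actLin, h.actR_vs, h.actR_vu]
  module

lemma crossForm_eq (h : EigenFrame A lam vs vu cs cu) (n : Fin 2 → ℤ) :
    (crossForm A n : ℝ) = cs (fun i => (n i : ℝ)) * cu (fun i => (n i : ℝ)) *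
      ((lam - lam⁻¹) * (vs 0 * vu 1 - vs 1 * vu 0)) := by
  set v : V := fun i => (n i : ℝ) with hv
  have hA : ∀ i, ((A.mulVec n i : ℤ) : ℝ) = actR A v i := by
    intro i
    simp [hv, actR, Matrix.mulVec, dotProduct]
  have h2 : actR A v = (lam⁻¹ * cs v) • vs + (lam * cu v) • vu := by
    conv_lhs => rw [h.decomp v]
    rw [h.actR_coord]
  have h3 : ∀ i, (n i : ℝ) = cs v * vs i + cu v * vu i := fun i => congrFun (h.decomp v) i
  simp only [crossForm, Int.cast_sub, Int.cast_mul, hA, h2]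
  rw [h3 0, h3 1]
  simp only [Pi.add_apply, Pi.smul_apply, smul_eq_mul]
  ring

/-- Some lattice vector minimises the absolute value of the product of the eigencoordinates
among all nonzero lattice vectors, and its minimum is positive. -/
lemma exists_minimal (h : EigenFrame A lam vs vu cs cu) (hdet : A.det = 1) (htr : 2 < A.trace)
    (hvs : vs ≠ 0) (hvu : vu ≠ 0) :
    ∃ m ∈ latticeGroup, 0 < |cs m| * |cu m| ∧
      ∀ n ∈ latticeGroup, n ≠ 0 → |cs m| * |cu m| ≤ |cs n| * |cu n| := by
  have hK : 0 < |(lam - lam⁻¹) * (vs 0 * vu 1 - vs 1 * vu 0)| := by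
    refine abs_pos.2 (mul_ne_zero ?_ (cross_ne_zero h.one_lt hvs hvu h.actR_vs h.actR_vu))
    have := inv_lt_one_of_one_lt₀ h.one_lt
    have := h.one_lt
    linarith
  set K := |(lam - lam⁻¹) * (vs 0 * vu 1 - vs 1 * vu 0)|
  have key : ∀ n : Fin 2 → ℤ, ((crossForm A n).natAbs : ℝ) =
      |cs (fun i => (n i : ℝ))| * |cu (fun i => (n i : ℝ))| * K := by
    intro n
    rw [Nat.cast_natAbs, Int.cast_abs, h.crossForm_eq, abs_mul, abs_mul]
  obtain ⟨m, hm, hmin⟩ := WellFounded.has_min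
    (measure fun n : Fin 2 → ℤ => (crossForm A n).natAbs).wf {n | n ≠ 0}
    ⟨fun _ => 1, fun h => one_ne_zero (congrFun h 0)⟩
  refine ⟨fun i => (m i : ℝ), ⟨m, rfl⟩, ?_, ?_⟩
  · refine pos_of_mul_pos_left ?_ hK.le
    rw [← key]
    exact_mod_cast Int.natAbs_pos.2 (crossForm_ne_zero hdet htr hm)
  · rintro _ ⟨n, rfl⟩ hn
    refine le_of_mul_le_mul_right ?_ hK
    rw [← key, ← key]
    exact_mod_cast not_lt.1 (hmin n fun h0 => hn (by ext i; simp [h0]))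

end EigenFrame

lemma exists_pow_le_of_lt_one {ρ η : ℝ} (h0 : 0 ≤ ρ) (h1 : ρ < 1) (hη : 0 < η) :
    ∃ N : ℕ, 0 < N ∧ ρ ^ N ≤ η := by
  obtain ⟨n, hn⟩ := exists_pow_lt_of_lt_one hη h1
  exact ⟨n + 1, n.succ_pos, (pow_le_pow_of_le_one h0 h1.le n.le_succ).trans hn.le⟩

lemma pow_mul_inv_pow_le {lam : ℝ} (hlam : 1 < lam) {r e P : ℕ} (h : r + e ≤ P) :
    lam ^ r * lam⁻¹ ^ P ≤ lam⁻¹ ^ e := by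
  have h0 : 0 < lam := by linarith
  obtain ⟨f, rfl⟩ := Nat.exists_eq_add_of_le h
  have h1 : lam ^ r * lam⁻¹ ^ (r + e + f) = lam⁻¹ ^ e * lam⁻¹ ^ f := by
    rw [pow_add, pow_add, ← mul_assoc, ← mul_assoc, ← mul_pow, mul_inv_cancel₀ h0.ne', one_pow,
      one_mul]
  rw [h1]
  exact mul_le_of_le_one_right (by positivity)
    (pow_le_one₀ (by positivity) (inv_lt_one_of_one_lt₀ hlam).le)

/-- A point of period `P` on the torus, homoclinic to the origin up to an error tending to zero
with `P`, after `r` iterations. -/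
noncomputable def bump (lam σ μ : ℝ) (vs vu : V) (P r : ℕ) : V :=
  (-(σ / (1 - lam⁻¹ ^ P)) * lam⁻¹ ^ r) • vs + (μ / (1 - lam⁻¹ ^ P) * (lam ^ r * lam⁻¹ ^ P)) • vu

/-- The sum of three iterates of `bump`. -/
noncomputable def tripleBump (lam σ μ : ℝ) (vs vu : V) (P r₁ r₂ r₃ : ℕ) : V :=
  bump lam σ μ vs vu P r₁ + bump lam σ μ vs vu P r₂ + bump lam σ μ vs vu P r₃

lemma tripleBump_eq (lam σ μ : ℝ) (vs vu : V) (P r₁ r₂ r₃ : ℕ) :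
    tripleBump lam σ μ vs vu P r₁ r₂ r₃ =
      (-(σ / (1 - lam⁻¹ ^ P)) * (lam⁻¹ ^ r₁ + lam⁻¹ ^ r₂ + lam⁻¹ ^ r₃)) • vs +
      (μ / (1 - lam⁻¹ ^ P) *
        (lam ^ r₁ * lam⁻¹ ^ P + lam ^ r₂ * lam⁻¹ ^ P + lam ^ r₃ * lam⁻¹ ^ P)) • vu := by
  simp only [tripleBump, bump]
  module

/-- Size estimates for the coordinates of a sum of three well-separated bumps. -/
lemma triple_bounds {lam : ℝ} (hlam : 1 < lam) {N r₁ r₂ r₃ : ℕ} (h₁₂ : r₁ + N ≤ r₂)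
    (h₂₃ : r₂ + N ≤ r₃) (h₃ : r₃ < 6 * N) (h₃₁ : r₃ ≤ r₁ + 5 * N) :
    lam⁻¹ ^ r₁ + lam⁻¹ ^ r₂ + lam⁻¹ ^ r₃ ≤ 3 ∧
    lam ^ r₁ * lam⁻¹ ^ (6 * N) + lam ^ r₂ * lam⁻¹ ^ (6 * N) + lam ^ r₃ * lam⁻¹ ^ (6 * N) ≤
      lam⁻¹ + 2 * lam⁻¹ ^ N ∧
    (lam⁻¹ ^ r₁ + lam⁻¹ ^ r₂ + lam⁻¹ ^ r₃) *
      (lam ^ r₁ * lam⁻¹ ^ (6 * N) + lam ^ r₂ * lam⁻¹ ^ (6 * N) + lam ^ r₃ * lam⁻¹ ^ (6 * N)) ≤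
      9 * lam⁻¹ ^ N := by
  have h0 : 0 < lam := by linarith
  have hle : ∀ r, lam⁻¹ ^ r ≤ 1 := fun r =>
    pow_le_one₀ (by positivity) (inv_lt_one_of_one_lt₀ hlam).le
  have hmix : ∀ i j, j + N ≤ 6 * N + i →
      lam⁻¹ ^ i * (lam ^ j * lam⁻¹ ^ (6 * N)) ≤ lam⁻¹ ^ N := by
    intro i j hij
    rw [mul_left_comm, ← pow_add]
    exact pow_mul_inv_pow_le hlam (by omega)
  refine ⟨by linarith [hle r₁, hle r₂, hle r₃], ?_, ?_⟩
  · have h1 := pow_mul_inv_pow_le hlam (show r₁ + N ≤ 6 * N by omega)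
    have h2 := pow_mul_inv_pow_le hlam (show r₂ + N ≤ 6 * N by omega)
    have h3 := pow_mul_inv_pow_le hlam (show r₃ + 1 ≤ 6 * N by omega)
    rw [pow_one] at h3
    linarith
  · have := hmix r₁ r₁ (by omega)
    have := hmix r₁ r₂ (by omega)
    have := hmix r₁ r₃ (by omega)
    have := hmix r₂ r₁ (by omega)
    have := hmix r₂ r₂ (by omega)
    have := hmix r₂ r₃ (by omega)
    have := hmix r₃ r₁ (by omega)
    have := hmix r₃ r₂ (by omega)
    have := hmix r₃ r₃ (by omega)
    simp only [add_mul, mul_add] at *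
    linarith

namespace EigenFrame

variable {A : Matrix (Fin 2) (Fin 2) ℤ} {lam : ℝ} {vs vu : V} {cs cu : V →ₗ[ℝ] ℝ}

lemma actR_bump (h : EigenFrame A lam vs vu cs cu) (σ μ : ℝ) (P r : ℕ) :
    actR A (bump lam σ μ vs vu P r) = bump lam σ μ vs vu P (r + 1) := by
  simp only [bump, h.actR_coord]
  congr 2 <;> ring

lemma bump_add_mul_sub_mem (h : EigenFrame A lam vs vu cs cu) {m : V} (hm : m ∈ latticeGroup)
    {P : ℕ} (hP : 0 < P) (r k : ℕ) :
    bump lam (cs m) (cu m) vs vu P (r + P * k) - bump lam (cs m) (cu m) vs vu P r ∈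
      latticeGroup := by
  have hlam := h.one_lt
  have h0 : lam ≠ 0 := by linarith
  have hε : 1 - lam⁻¹ ^ P ≠ 0 :=
    (sub_pos.2 (pow_lt_one₀ (by positivity) (inv_lt_one_of_one_lt₀ hlam) hP.ne')).ne'
  have hone : ∀ r, bump lam (cs m) (cu m) vs vu P (r + P) - bump lam (cs m) (cu m) vs vu P r ∈
      latticeGroup := by
    intro r
    induction r with
    | zero =>
      convert hm
      conv_rhs => rw [h.decomp m]
      have hpow : lam ^ P * lam⁻¹ ^ P = 1 := by
        rw [← mul_pow, mul_inv_cancel₀ h0, one_pow]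
      simp only [bump, zero_add, pow_zero, hpow]
      have e1 : cs m = cs m / (1 - lam⁻¹ ^ P) * (1 - lam⁻¹ ^ P) := (div_mul_cancel₀ _ hε).symm
      have e2 : cu m = cu m / (1 - lam⁻¹ ^ P) * (1 - lam⁻¹ ^ P) := (div_mul_cancel₀ _ hε).symm
      generalize cs m / (1 - lam⁻¹ ^ P) = a at *
      generalize cu m / (1 - lam⁻¹ ^ P) = b at *
      rw [e1, e2]
      module
    | succ r ih =>
      have := actR_mem_lattice A ih
      rwa [actR_eq_actLin, map_sub, ← actR_eq_actLin, h.actR_bump, h.actR_bump,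
        add_right_comm] at this
  induction k with
  | zero => simp
  | succ k ih =>
    have := latticeGroup.add_mem (hone (r + P * k)) ih
    rwa [sub_add_sub_cancel, add_assoc, ← mul_add_one] at this

lemma tripleBump_sub_mem (h : EigenFrame A lam vs vu cs cu) {m : V} (hm : m ∈ latticeGroup)
    {P : ℕ} (hP : 0 < P) (r₁ r₂ r₃ k₁ k₂ k₃ : ℕ) :
    tripleBump lam (cs m) (cu m) vs vu P (r₁ + P * k₁) (r₂ + P * k₂) (r₃ + P * k₃) -
      tripleBump lam (cs m) (cu m) vs vu P r₁ r₂ r₃ ∈ latticeGroup := by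
  have := latticeGroup.add_mem (latticeGroup.add_mem (h.bump_add_mul_sub_mem hm hP r₁ k₁)
    (h.bump_add_mul_sub_mem hm hP r₂ k₂)) (h.bump_add_mul_sub_mem hm hP r₃ k₃)
  simp only [tripleBump]
  rwa [add_sub_add_comm, add_sub_add_comm]

lemma iterate_tripleBump (h : EigenFrame A lam vs vu cs cu) (σ μ : ℝ) (P r₁ r₂ r₃ i : ℕ) :
    (actR A)^[i] (tripleBump lam σ μ vs vu P r₁ r₂ r₃) =
      tripleBump lam σ μ vs vu P (r₁ + i) (r₂ + i) (r₃ + i) := by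
  induction i with
  | zero => rfl
  | succ i ih =>
    rw [Function.iterate_succ_apply', ih, tripleBump, actR_eq_actLin, map_add, map_add,
      ← actR_eq_actLin, h.actR_bump, h.actR_bump, h.actR_bump]
    rfl

lemma tripleBump_swap (lam σ μ : ℝ) (vs vu : V) (P r₁ r₂ r₃ : ℕ) :
    tripleBump lam σ μ vs vu P r₁ r₂ r₃ = tripleBump lam σ μ vs vu P r₃ r₁ r₂ := by
  simp only [tripleBump]; abel

/-- Modulo the lattice, each point of the orbit is a sum of three bumps whose positions in the
period are cyclically `N`-separated. -/
lemma exists_sorted_triple (h : EigenFrame A lam vs vu cs cu) {m : V} (hm : m ∈ latticeGroup)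
    {N : ℕ} (hN : 0 < N) (i : ℕ) :
    ∃ r₁ r₂ r₃, r₁ + N ≤ r₂ ∧ r₂ + N ≤ r₃ ∧ r₃ < 6 * N ∧ r₃ ≤ r₁ + 5 * N ∧
      (actR A)^[i] (tripleBump lam (cs m) (cu m) vs vu (6 * N) 0 N (3 * N)) -
        tripleBump lam (cs m) (cu m) vs vu (6 * N) r₁ r₂ r₃ ∈ latticeGroup := by
  rw [h.iterate_tripleBump]
  have hP : 0 < 6 * N := by omega
  have hr := Nat.mod_lt i hP
  have hi := Nat.mod_add_div i (6 * N)
  set r := i % (6 * N)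
  set k := i / (6 * N)
  rcases lt_or_ge r (3 * N) with h1 | h1
  · refine ⟨r, r + N, r + 3 * N, by omega, by omega, by omega, by omega, ?_⟩
    convert h.tripleBump_sub_mem hm hP r (r + N) (r + 3 * N) k k k using 3 <;> omega
  rcases lt_or_ge r (5 * N) with h2 | h2
  · refine ⟨r - 3 * N, r, r + N, by omega, by omega, by omega, by omega, ?_⟩
    rw [tripleBump_swap]
    convert h.tripleBump_sub_mem hm hP (r - 3 * N) r (r + N) (k + 1) k k using 3 <;>
      (try rw [mul_add_one]) <;> omega
  · refine ⟨r - 5 * N, r - 3 * N, r, by omega, by omega, by omega, by omega, ?_⟩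
    rw [tripleBump_swap, tripleBump_swap]
    convert h.tripleBump_sub_mem hm hP (r - 5 * N) (r - 3 * N) r (k + 1) (k + 1) k using 3 <;>
      (try rw [mul_add_one]) <;> omega

/-- Points of the stable line of the origin other than the origin are not periodic. -/
lemma smul_vs_notMem (h : EigenFrame A lam vs vu cs cu)
    (hlat : ∀ n ∈ latticeGroup, cu n = 0 → n = 0) {E : Set V} (hE : IsTorusFinite E)
    (hEinv : ∀ v ∈ E, actR A v ∈ E) {a : ℝ} (ha : a ≠ 0) : a • vs ∉ E := by
  intro haE
  have hiter : ∀ i : ℕ, (lam⁻¹ ^ i * a) • vs ∈ E := by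
    intro i
    induction i with
    | zero => simpa using haE
    | succ i ih =>
      have := hEinv _ ih
      have e := h.actR_coord (lam⁻¹ ^ i * a) 0
      simp only [zero_smul, add_zero, mul_zero] at e
      rwa [e, ← mul_assoc, ← pow_succ'] at this
  obtain ⟨F, hF, rfl⟩ := hE
  choose f hf l hl hfl using hiter
  have := hF.to_subtype
  obtain ⟨i, j, hij, hfij⟩ := Finite.exists_ne_map_eq_of_infinite
    (fun i => (⟨f i, hf i⟩ : F))
  rw [Subtype.mk.injEq] at hfij
  have hmem := latticeGroup.sub_mem (show l i ∈ latticeGroup from hl i)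
    (show l j ∈ latticeGroup from hl j)
  have heq : l i - l j = (lam⁻¹ ^ i * a - lam⁻¹ ^ j * a) • vs := by
    have h1 : f i + l i = _ := hfl i
    have h2 : f j + l j = _ := hfl j
    rw [sub_smul, ← h1, ← h2, hfij]
    abel
  rw [heq] at hmem
  have h0 := hlat _ hmem (by simp [h.cu_vs])
  have h1 := congrArg cs h0
  rw [map_smul, h.cs_vs, map_zero, smul_eq_mul, mul_one, sub_eq_zero] at h1
  have hlam := h.one_lt
  exact hij (pow_right_injective₀ (by positivity)
    (inv_lt_one_of_one_lt₀ hlam).ne (mul_right_cancel₀ ha h1))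

lemma exists_box_disjoint (h : EigenFrame A lam vs vu cs cu)
    (hlat : ∀ n ∈ latticeGroup, cu n = 0 → n = 0) {E : Set V} (hE : IsTorusFinite E)
    (hEinv : ∀ v ∈ E, actR A v ∈ E) {σ : ℝ} (hσ : σ ≠ 0) :
    ∃ δ > 0, ∀ a b : ℝ, |a + σ| < δ → |b| < δ → a • vs + b • vu ∉ E := by
  have hcont : Continuous fun p : ℝ × ℝ => p.1 • vs + p.2 • vu := by fun_prop
  have hopen := hE.isClosed.isOpen_compl.preimage hcont
  obtain ⟨δ, hδ, hball⟩ := Metric.isOpen_iff.1 hopen (-σ, 0) (by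
    simpa using h.smul_vs_notMem hlat hE hEinv (neg_ne_zero.2 hσ))
  refine ⟨δ, hδ, fun a b ha hb => hball (show (a, b) ∈ Metric.ball (-σ, (0 : ℝ)) δ from ?_)⟩
  rw [Metric.mem_ball, Prod.dist_eq, max_lt_iff, Real.dist_eq, Real.dist_eq]
  simpa using ⟨ha, hb⟩

end EigenFrame

/-- The numerical estimate separating the orbit from its mirror image. -/
lemma product_lt {σ μ κ ρ t S U δ a b : ℝ} (hσμ : 0 < |σ| * |μ|) (ht : 0 ≤ t)
    (hρ : 0 ≤ ρ) (hρ1 : ρ < 1) (htρ : 100 * t ≤ 1 - ρ) (hκ0 : 0 ≤ κ) (hκ : κ ≤ 1 + 2 * t)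
    (hS0 : 0 ≤ S) (hS : S ≤ 3) (hU0 : 0 ≤ U) (hU : U ≤ ρ + 2 * t) (hSU : S * U ≤ 9 * t)
    (hδσ : δ ≤ |σ|) (hδ : δ * (8 * |σ| + 6 * |μ|) ≤ (1 - ρ) / 4 * (|σ| * |μ|))
    (ha : |a + σ| ≤ δ) (hb : |b| ≤ δ) :
    |a - σ * κ * S| * |b + μ * κ * U| < |σ| * |μ| := by
  have hδ0 : 0 ≤ δ := (abs_nonneg _).trans hb
  have hκ2 : κ ≤ 2 := by linarith
  have hκS : κ * S ≤ 6 := by nlinarith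
  have hκU : κ * U ≤ 6 := by nlinarith
  have hκS0 : 0 ≤ κ * S := by positivity
  have hκU0 : 0 ≤ κ * U := by positivity
  have h1 : |a - σ * κ * S| ≤ |σ| * (1 + κ * S) + δ := by
    calc |a - σ * κ * S| = |(a + σ) - σ * (1 + κ * S)| := by ring_nf
      _ ≤ |a + σ| + |σ * (1 + κ * S)| := abs_sub _ _
      _ = |a + σ| + |σ| * (1 + κ * S) := by
        rw [abs_mul, abs_of_nonneg (by linarith : 0 ≤ 1 + κ * S)]
      _ ≤ _ := by linarith
  have h2 : |b + μ * κ * U| ≤ |μ| * (κ * U) + δ := by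
    calc |b + μ * κ * U| ≤ |b| + |μ * κ * U| := abs_add_le _ _
      _ = |b| + |μ| * (κ * U) := by rw [mul_assoc, abs_mul, abs_of_nonneg hκU0]
      _ ≤ _ := by linarith
  have h3 : (1 + κ * S) * (κ * U) ≤ ρ + 50 * t := by
    have e1 : κ * U ≤ (1 + 2 * t) * (ρ + 2 * t) := mul_le_mul hκ hU hU0 (by linarith)
    have e2 : κ * κ ≤ 2 * 2 := mul_le_mul hκ2 hκ2 hκ0 (by norm_num)
    have e3 : κ * κ * (S * U) ≤ 4 * (9 * t) := by
      refine mul_le_mul (by linarith) hSU (by positivity) (by norm_num)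
    have e4 : t * t ≤ t := by nlinarith
    have e5 : t * ρ ≤ t := by nlinarith
    nlinarith
  have h4 : |a - σ * κ * S| * |b + μ * κ * U| ≤
      (|σ| * (1 + κ * S) + δ) * (|μ| * (κ * U) + δ) :=
    mul_le_mul h1 h2 (abs_nonneg _) (by positivity)
  have h5 : (|σ| * |μ|) * ((1 + κ * S) * (κ * U)) ≤ (|σ| * |μ|) * (ρ + 50 * t) :=
    mul_le_mul_of_nonneg_left h3 hσμ.le
  have h6 : |σ| * (1 + κ * S) + |μ| * (κ * U) + δ ≤ 8 * |σ| + 6 * |μ| := by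
    have := mul_le_mul_of_nonneg_left hκS (abs_nonneg σ)
    have := mul_le_mul_of_nonneg_left hκU (abs_nonneg μ)
    linarith
  have h7 := mul_le_mul_of_nonneg_left h6 hδ0
  have h8 : (|σ| * |μ|) * (50 * t) ≤ (|σ| * |μ|) * ((1 - ρ) / 2) :=
    mul_le_mul_of_nonneg_left (by linarith) hσμ.le
  have h9 : 0 < (|σ| * |μ|) * (1 - ρ) := mul_pos hσμ (by linarith)
  nlinarith

/-- Three explicit points inside a box avoiding `T` span a positive and a negative rectangle. -/
lemma exists_rects_of_three_points {vs vu : V} {X T : Set V} {σ μ κ t δ : ℝ} (ht0 : 0 < t)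
    (ht1 : t ≤ 1 / 100) (hσ : σ ≠ 0) (hμ : μ ≠ 0) (hκ1 : 1 ≤ κ) (hκ2 : κ ≤ 1 + 2 * t)
    (htD : t * (8 * |σ| + 6 * |μ|) ≤ δ)
    (havoid : ∀ a b : ℝ, |a + σ| ≤ δ → |b| ≤ δ → a • vs + b • vu ∉ T)
    (hp₀ : (-(σ * κ * (t ^ 0 + t ^ 1 + t ^ 3))) • vs +
      (μ * κ * (t ^ 6 + t ^ 5 + t ^ 3)) • vu ∈ X)
    (hp₁ : (-(σ * κ * (t ^ 5 + t ^ 0 + t ^ 2))) • vs +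
      (μ * κ * (t ^ 1 + t ^ 6 + t ^ 4)) • vu ∈ X)
    (hp₂ : (-(σ * κ * (t ^ 3 + t ^ 4 + t ^ 0))) • vs +
      (μ * κ * (t ^ 3 + t ^ 2 + t ^ 6)) • vu ∈ X) :
    (∃ R : Rect, R.IsPos vs vu X ∧ Disjoint (R.carrier vs vu) T) ∧
      (∃ R : Rect, R.IsNeg vs vu X ∧ Disjoint (R.carrier vs vu) T) := by
  have hσa := abs_pos.2 hσ
  have hμa := abs_pos.2 hμ
  have hle : ∀ k ≠ 0, t ^ k ≤ t := fun k => pow_le_of_le_one ht0.le (by linarith)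
  have hp : ∀ k, 0 < t ^ k := fun k => pow_pos ht0 k
  have ha : ∀ S, 1 ≤ S → S ≤ 1 + 2 * t → -(σ * κ * S) ∈ Set.Icc (-σ - δ) (-σ + δ) := by
    intro S h1 h2
    have h3 : 0 ≤ κ * S - 1 := by nlinarith
    have h4 : κ * S - 1 ≤ 8 * t := by
      have := mul_le_mul hκ2 h2 (by linarith) (by linarith)
      nlinarith
    have h5 : |σ * (κ * S - 1)| ≤ δ := by
      rw [abs_mul, abs_of_nonneg h3]
      have := mul_le_mul_of_nonneg_left h4 hσa.le
      have : 0 ≤ t * |μ| := by positivity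
      linarith
    have := abs_le.1 h5
    constructor <;> linarith
  have hb : ∀ U, 0 ≤ U → U ≤ 3 * t → μ * κ * U ∈ Set.Icc (-δ) δ := by
    intro U h1 h2
    have h4 : κ * U ≤ 6 * t := by
      have := mul_le_mul hκ2 h2 h1 (by linarith)
      nlinarith
    refine abs_le.1 ?_
    rw [mul_assoc, abs_mul, abs_of_nonneg (by positivity : 0 ≤ κ * U)]
    have := mul_le_mul_of_nonneg_left h4 hμa.le
    have : 0 ≤ t * |σ| := by positivity
    linarith
  have ha₀ := ha (t ^ 0 + t ^ 1 + t ^ 3) (by linarith [hp 1, hp 3, pow_zero t])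
    (by linarith [hle 1 (by norm_num), hle 3 (by norm_num), pow_zero t])
  have ha₁ := ha (t ^ 5 + t ^ 0 + t ^ 2) (by linarith [hp 5, hp 2, pow_zero t])
    (by linarith [hle 5 (by norm_num), hle 2 (by norm_num), pow_zero t])
  have ha₂ := ha (t ^ 3 + t ^ 4 + t ^ 0) (by linarith [hp 3, hp 4, pow_zero t])
    (by linarith [hle 3 (by norm_num), hle 4 (by norm_num), pow_zero t])
  have hb₀ := hb (t ^ 6 + t ^ 5 + t ^ 3) (by positivity) (by linarith [hle 6 (by norm_num), hle 5 (by norm_num), hle 3 (by norm_num)])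
  have hb₁ := hb (t ^ 1 + t ^ 6 + t ^ 4) (by positivity) (by linarith [hle 1 (by norm_num), hle 6 (by norm_num), hle 4 (by norm_num)])
  have hb₂ := hb (t ^ 3 + t ^ 2 + t ^ 6) (by positivity) (by linarith [hle 3 (by norm_num), hle 2 (by norm_num), hle 6 (by norm_num)])
  have hdisj : ∀ (R : Rect) (a₁ a₂ b₁ b₂ : ℝ), a₁ ∈ Set.Icc (-σ - δ) (-σ + δ) →
      a₂ ∈ Set.Icc (-σ - δ) (-σ + δ) → b₁ ∈ Set.Icc (-δ) δ → b₂ ∈ Set.Icc (-δ) δ →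
      (∀ q ∈ R.carrier vs vu, ∃ a ∈ Set.uIcc a₁ a₂, ∃ b ∈ Set.uIcc b₁ b₂,
        q = a • vs + b • vu) → Disjoint (R.carrier vs vu) T := by
    intro R a₁ a₂ b₁ b₂ h₁ h₂ h₃ h₄ hR
    rw [Set.disjoint_left]
    intro q hq
    obtain ⟨a, ha, b, hb, rfl⟩ := hR q hq
    have ha' := Set.uIcc_subset_Icc h₁ h₂ ha
    exact havoid a b (abs_le.2 ⟨by linarith [ha'.1], by linarith [ha'.2]⟩)
      (abs_le.2 (Set.uIcc_subset_Icc h₃ h₄ hb))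
  have hκsq : 0 < κ ^ 2 := by positivity
  have h1 : 0 < 1 - t := by linarith
  have h2 : 0 < 1 - t ^ 2 := by nlinarith
  have hS₁₀ : 0 < t ^ 0 + t ^ 1 + t ^ 3 - (t ^ 5 + t ^ 0 + t ^ 2) := by
    have : 0 < t * (1 - t) + t ^ 3 * (1 - t ^ 2) := by positivity
    linarith
  have hU₁₀ : 0 < t ^ 1 + t ^ 6 + t ^ 4 - (t ^ 6 + t ^ 5 + t ^ 3) := by
    have : 0 < t * (1 - t ^ 2) + t ^ 4 * (1 - t) := by positivity
    linarith
  have hS₂₁ : 0 < t ^ 5 + t ^ 0 + t ^ 2 - (t ^ 3 + t ^ 4 + t ^ 0) := by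
    have : 0 < t ^ 2 * ((1 - t) * (1 - t ^ 2)) := by positivity
    linarith
  have hU₂₁ : 0 < t ^ 1 + t ^ 6 + t ^ 4 - (t ^ 3 + t ^ 2 + t ^ 6) := by
    have : 0 < t * ((1 - t) * (1 - t ^ 2)) := by positivity
    linarith
  generalize t ^ 0 + t ^ 1 + t ^ 3 = S₀, t ^ 5 + t ^ 0 + t ^ 2 = S₁,
    t ^ 3 + t ^ 4 + t ^ 0 = S₂, t ^ 6 + t ^ 5 + t ^ 3 = U₀, t ^ 1 + t ^ 6 + t ^ 4 = U₁,
    t ^ 3 + t ^ 2 + t ^ 6 = U₂ at *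
  have e₁₀ := mul_pos hκsq (mul_pos hS₁₀ hU₁₀)
  have e₂₁ := mul_pos hκsq (mul_pos hS₂₁ hU₂₁)
  have f₁₀ : (-(σ * κ * S₁) - -(σ * κ * S₀)) * (μ * κ * U₁ - μ * κ * U₀) =
      (σ * μ) * (κ ^ 2 * ((S₀ - S₁) * (U₁ - U₀))) := by ring
  have f₂₁ : (-(σ * κ * S₂) - -(σ * κ * S₁)) * (μ * κ * U₂ - μ * κ * U₁) =
      -(σ * μ) * (κ ^ 2 * ((S₁ - S₂) * (U₁ - U₂))) := by ring
  rcases lt_or_gt_of_ne (mul_ne_zero hσ hμ) with hsign | hsign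
  · obtain ⟨R, hR, hRc⟩ := Rect.exists_isPos hp₁ hp₂
      (by rw [f₂₁]; exact mul_pos (neg_pos.2 hsign) e₂₁)
    obtain ⟨R', hR', hRc'⟩ :=
      Rect.exists_isNeg hp₀ hp₁ (by rw [f₁₀]; exact mul_neg_of_neg_of_pos hsign e₁₀)
    exact ⟨⟨R, hR, hdisj R _ _ _ _ ha₁ ha₂ hb₁ hb₂ hRc⟩,
      ⟨R', hR', hdisj R' _ _ _ _ ha₀ ha₁ hb₀ hb₁ hRc'⟩⟩
  · obtain ⟨R, hR, hRc⟩ := Rect.exists_isPos hp₀ hp₁ (by rw [f₁₀]; exact mul_pos hsign e₁₀)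
    obtain ⟨R', hR', hRc'⟩ := Rect.exists_isNeg hp₁ hp₂
      (by rw [f₂₁]; exact mul_neg_of_neg_of_pos (neg_neg_of_pos hsign) e₂₁)
    exact ⟨⟨R, hR, hdisj R _ _ _ _ ha₀ ha₁ hb₀ hb₁ hRc⟩,
      ⟨R', hR', hdisj R' _ _ _ _ ha₁ ha₂ hb₁ hb₂ hRc'⟩⟩

namespace EigenFrame

variable {A : Matrix (Fin 2) (Fin 2) ℤ} {lam : ℝ} {vs vu : V} {cs cu : V →ₗ[ℝ] ℝ}

lemma isPeriodicOrbit_tripleBump (h : EigenFrame A lam vs vu cs cu) {m : V}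
    (hm : m ∈ latticeGroup) {P : ℕ} (hP : 0 < P) (r₁ r₂ r₃ : ℕ) :
    IsPeriodicOrbit A {v | ∃ i : ℕ, v - (actR A)^[i]
      (tripleBump lam (cs m) (cu m) vs vu P r₁ r₂ r₃) ∈ lattice} := by
  refine ⟨_, P, hP, ?_, rfl⟩
  rw [h.iterate_tripleBump]
  have := h.tripleBump_sub_mem hm hP r₁ r₂ r₃ 1 1 1
  rwa [mul_one] at this

/-- There is a periodic orbit with a positive and a negative rectangle, both disjoint from a given
finite invariant set and from the mirror image of the orbit. -/
lemma exists_periodicOrbit (h : EigenFrame A lam vs vu cs cu) (hdet : A.det = 1)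
    (htr : 2 < A.trace) (hvs : vs ≠ 0) (hvu : vu ≠ 0) {E : Set V} (hE : IsTorusFinite E)
    (hEinv : ∀ v ∈ E, actR A v ∈ E) :
    ∃ X : Set V, IsPeriodicOrbit A X ∧
      (∃ R : Rect, R.IsPos vs vu X ∧ Disjoint (R.carrier vs vu) (-X ∪ E)) ∧
      (∃ R : Rect, R.IsNeg vs vu X ∧ Disjoint (R.carrier vs vu) (-X ∪ E)) := by
  obtain ⟨m, hm, hpos, hmin⟩ := h.exists_minimal hdet htr hvs hvu
  have hlam := h.one_lt
  have hlam0 : 0 < lam := by linarith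
  have hρ0 : 0 < lam⁻¹ := inv_pos.2 hlam0
  have hρ1 : lam⁻¹ < 1 := inv_lt_one_of_one_lt₀ hlam
  have hσ : cs m ≠ 0 := by rintro h0; simp [h0] at hpos
  have hμ : cu m ≠ 0 := by rintro h0; simp [h0] at hpos
  have hlat : ∀ n ∈ latticeGroup, cu n = 0 → n = 0 := by
    intro n hn h0
    by_contra hne
    have := hmin n hn hne
    rw [h0, abs_zero, mul_zero] at this
    linarith
  obtain ⟨δE, hδE, hbox⟩ := h.exists_box_disjoint hlat hE hEinv hσ
  have hσa := abs_pos.2 hσ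
  have hμa := abs_pos.2 hμ
  set σ := cs m with hσdef
  set μ := cu m with hμdef
  set D := 8 * |σ| + 6 * |μ| with hD
  have hDpos : 0 < D := by positivity
  obtain ⟨δ, hδ0, hδ1, hδ2, hδ3⟩ : ∃ δ > 0, δ < δE ∧ δ < |σ| ∧
      δ * D ≤ (1 - lam⁻¹) / 4 * (|σ| * |μ|) := by
    have hη : 0 < (1 - lam⁻¹) / 4 * (|σ| * |μ|) / D :=
      div_pos (mul_pos (by linarith) hpos) hDpos
    obtain ⟨δ, hδ, hlt⟩ := exists_between (lt_min hη (lt_min hδE hσa))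
    simp only [lt_min_iff] at hlt
    exact ⟨δ, hδ, hlt.2.1, hlt.2.2, ((lt_div_iff₀ hDpos).1 hlt.1).le⟩
  obtain ⟨N, hN, hNt⟩ := exists_pow_le_of_lt_one hρ0.le hρ1
    (lt_min (show 0 < (1 - lam⁻¹) / 100 by linarith) (show 0 < δ / D by positivity))
  have htρ : 100 * lam⁻¹ ^ N ≤ 1 - lam⁻¹ := by
    have := hNt.trans (min_le_left _ _)
    linarith
  have htD : lam⁻¹ ^ N * D ≤ δ := (le_div_iff₀ hDpos).1 (hNt.trans (min_le_right _ _))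
  have ht0 : 0 < lam⁻¹ ^ N := by positivity
  have hP : 0 < 6 * N := by omega
  set X : Set V := {v | ∃ i : ℕ, v - (actR A)^[i]
      (tripleBump lam σ μ vs vu (6 * N) 0 N (3 * N)) ∈ lattice} with hXdef
  have hX : IsPeriodicOrbit A X := h.isPeriodicOrbit_tripleBump hm hP 0 N (3 * N)
  have hε : lam⁻¹ ^ (6 * N) = (lam⁻¹ ^ N) ^ 6 := by rw [mul_comm, pow_mul]
  set t := lam⁻¹ ^ N with ht
  have hεt : t ^ 6 ≤ t := pow_le_of_le_one ht0.le (by linarith) (by norm_num)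
  set κ := 1 / (1 - t ^ 6) with hκdef
  have hκ1 : 1 ≤ κ := by
    rw [hκdef, le_div_iff₀ (by linarith)]
    linarith [pow_pos ht0 6]
  have hκ2 : κ ≤ 1 + 2 * t := by
    rw [hκdef, div_le_iff₀ (by linarith)]
    nlinarith
  have hcoord : ∀ r₁ r₂ r₃, tripleBump lam σ μ vs vu (6 * N) r₁ r₂ r₃ =
      (-(σ * κ * (lam⁻¹ ^ r₁ + lam⁻¹ ^ r₂ + lam⁻¹ ^ r₃))) • vs +
      (μ * κ * (lam ^ r₁ * lam⁻¹ ^ (6 * N) + lam ^ r₂ * lam⁻¹ ^ (6 * N) +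
        lam ^ r₃ * lam⁻¹ ^ (6 * N))) • vu := by
    intro r₁ r₂ r₃
    rw [tripleBump_eq, hε, hκdef, mul_one_div, mul_one_div, neg_mul]
  -- points of the box lie neither on the mirror orbit nor in `E`
  have havoid : ∀ a b : ℝ, |a + σ| ≤ δ → |b| ≤ δ → a • vs + b • vu ∉ -X ∪ E := by
    rintro a b ha hb (hq | hq)
    · obtain ⟨i, hi⟩ := hq
      obtain ⟨r₁, r₂, r₃, h₁₂, h₂₃, h₃, h₃₁, hr⟩ := h.exists_sorted_triple hm hN i
      obtain ⟨hS, hU, hSU⟩ := triple_bounds hlam h₁₂ h₂₃ h₃ h₃₁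
      have hn := latticeGroup.neg_mem (latticeGroup.add_mem hi hr)
      rw [← hσdef, ← hμdef, sub_add_sub_cancel, hcoord] at hn
      have hS0 : 0 ≤ lam⁻¹ ^ r₁ + lam⁻¹ ^ r₂ + lam⁻¹ ^ r₃ := by positivity
      have hU0 : 0 ≤ lam ^ r₁ * lam⁻¹ ^ (6 * N) + lam ^ r₂ * lam⁻¹ ^ (6 * N) +
        lam ^ r₃ * lam⁻¹ ^ (6 * N) := by positivity
      generalize lam⁻¹ ^ r₁ + lam⁻¹ ^ r₂ + lam⁻¹ ^ r₃ = S at *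
      generalize lam ^ r₁ * lam⁻¹ ^ (6 * N) + lam ^ r₂ * lam⁻¹ ^ (6 * N) +
        lam ^ r₃ * lam⁻¹ ^ (6 * N) = U at *
      rw [show -(-(a • vs + b • vu) - ((-(σ * κ * S)) • vs + (μ * κ * U) • vu)) =
        (a - σ * κ * S) • vs + (b + μ * κ * U) • vu by module] at hn
      have hlt := product_lt hpos ht0.le hρ0.le hρ1 htρ (by linarith) hκ2 hS0 hS hU0 hU hSU
        hδ2.le hδ3 ha hb
      have hne : (a - σ * κ * S) • vs + (b + μ * κ * U) • vu ≠ 0 := by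
        intro h0
        have h1 := congrArg cs h0
        rw [h.cs_coord, map_zero] at h1
        have h2 : a + σ = σ * (1 + κ * S) := by linear_combination h1
        rw [h2, abs_mul, abs_of_nonneg (by positivity : 0 ≤ 1 + κ * S)] at ha
        have : 0 ≤ |σ| * (κ * S) := by positivity
        linarith
      have := hmin _ hn hne
      rw [h.cs_coord, h.cu_coord] at this
      linarith
    · exact hbox a b (ha.trans_lt hδ1) (hb.trans_lt hδ1) hq
  -- the points of the orbit with one bump at position `0`
  have hmem : ∀ r₁ r₂ r₃ i k₁ k₂ k₃, 0 + i = r₁ + 6 * N * k₁ → N + i = r₂ + 6 * N * k₂ →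
      3 * N + i = r₃ + 6 * N * k₃ → tripleBump lam σ μ vs vu (6 * N) r₁ r₂ r₃ ∈ X := by
    intro r₁ r₂ r₃ i k₁ k₂ k₃ e₁ e₂ e₃
    refine ⟨i, ?_⟩
    rw [h.iterate_tripleBump, e₁, e₂, e₃, ← neg_sub]
    exact latticeGroup.neg_mem (h.tripleBump_sub_mem hm hP r₁ r₂ r₃ k₁ k₂ k₃)
  have hpow : ∀ k, lam⁻¹ ^ (k * N) = t ^ k := fun k => by rw [mul_comm, pow_mul]
  have hpow' : ∀ k l, k + l = 6 → lam ^ (k * N) * lam⁻¹ ^ (6 * N) = t ^ l := by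
    intro k l hkl
    rw [← hkl, add_mul, pow_add, ← mul_assoc, ← mul_pow, mul_inv_cancel₀ hlam0.ne', one_pow,
      one_mul, hpow]
  have hpt : ∀ k₁ k₂ k₃ l₁ l₂ l₃, k₁ + l₁ = 6 → k₂ + l₂ = 6 → k₃ + l₃ = 6 →
      tripleBump lam σ μ vs vu (6 * N) (k₁ * N) (k₂ * N) (k₃ * N) =
        (-(σ * κ * (t ^ k₁ + t ^ k₂ + t ^ k₃))) • vs +
        (μ * κ * (t ^ l₁ + t ^ l₂ + t ^ l₃)) • vu := by
    intro k₁ k₂ k₃ l₁ l₂ l₃ e₁ e₂ e₃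
    rw [hcoord, hpow, hpow, hpow, hpow' _ _ e₁, hpow' _ _ e₂, hpow' _ _ e₃]
  have hp₀ := hmem (0 * N) (1 * N) (3 * N) 0 0 0 0 (by ring) (by ring) (by ring)
  have hp₁ := hmem (5 * N) (0 * N) (2 * N) (5 * N) 0 1 1 (by ring) (by ring) (by ring)
  have hp₂ := hmem (3 * N) (4 * N) (0 * N) (3 * N) 0 0 1 (by ring) (by ring) (by ring)
  rw [hpt _ _ _ 6 5 3 rfl rfl rfl] at hp₀
  rw [hpt _ _ _ 1 6 4 rfl rfl rfl] at hp₁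
  rw [hpt _ _ _ 3 2 6 rfl rfl rfl] at hp₂
  exact ⟨X, hX, exists_rects_of_three_points ht0 (by linarith) hσ hμ hκ1 hκ2 htD havoid hp₀ hp₁ hp₂⟩

end EigenFrame

/-- given a finite `f_A`-invariant set `ℰ`, there are two disjoint
periodic orbits `γ₊, γ₋`, both disjoint from `ℰ`, with positive and negative
`γ₊`-rectangles disjoint from the lift of `γ₋ ∪ ℰ`, and positive and negative
`γ₋`-rectangles disjoint from the lift of `γ₊ ∪ ℰ`. -/
theorem statement_1 (A : Matrix (Fin 2) (Fin 2) ℤ) (hdet : A.det = 1) (htr : 2 < A.trace)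
    (lam : ℝ) (hlam : 1 < lam) (vs vu : V) (hvs : vs ≠ 0) (hvu : vu ≠ 0)
    (hAs : actR A vs = lam⁻¹ • vs) (hAu : actR A vu = lam • vu)
    (E : Set V) (hEfin : IsTorusFinite E) (hEinv : IsInvariant A E) :
    ∃ X Y : Set V, IsPeriodicOrbit A X ∧ IsPeriodicOrbit A Y ∧
      Disjoint X Y ∧ Disjoint X E ∧ Disjoint Y E ∧
      (∃ R : Rect, R.IsPos vs vu X ∧ Disjoint (R.carrier vs vu) (Y ∪ E)) ∧
      (∃ R : Rect, R.IsNeg vs vu X ∧ Disjoint (R.carrier vs vu) (Y ∪ E)) ∧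
      (∃ R : Rect, R.IsPos vs vu Y ∧ Disjoint (R.carrier vs vu) (X ∪ E)) ∧
      (∃ R : Rect, R.IsNeg vs vu Y ∧ Disjoint (R.carrier vs vu) (X ∪ E)) := by
  obtain ⟨cs, cu, h⟩ := exists_eigenFrame hlam hvs hvu hAs hAu
  have hEmem : ∀ v ∈ E, actR A v ∈ E := fun v hv => hEinv ▸ Set.mem_image_of_mem _ hv
  have hSfin := hEfin.union hEfin.neg
  have hS : ∀ v ∈ E ∪ -E, actR A v ∈ E ∪ -E := by
    rintro v (hv | hv)
    · exact Or.inl (hEmem v hv)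
    · refine Or.inr ?_
      rw [Set.mem_neg, ← actR_neg]
      exact hEmem _ hv
  obtain ⟨X, hX, ⟨R, hR, hRd⟩, ⟨R', hR', hRd'⟩⟩ :=
    h.exists_periodicOrbit hdet htr hvs hvu hSfin hS
  obtain ⟨hRX, hRE⟩ := Set.disjoint_union_right.1 hRd
  obtain ⟨hRX', hRE'⟩ := Set.disjoint_union_right.1 hRd'
  have hXE : Disjoint X (E ∪ -E) := by
    rw [Set.disjoint_left]
    intro v hv hvS
    exact Set.disjoint_left.1 hRE (R.p_mem_carrier vs vu)
      (hX.subset_of_mem hS (fun _ _ => hSfin.mem_of_sub_mem) hv hvS hR.1)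
  have hXX : Disjoint X (-X) := by
    rw [Set.disjoint_left]
    intro v hv hvS
    exact Set.disjoint_left.1 hRX (R.p_mem_carrier vs vu)
      (hX.subset_of_mem (fun _ => hX.neg.actR_mem) (fun _ _ => hX.neg.mem_of_sub_mem) hv hvS hR.1)
  obtain ⟨hXE₁, hXE₂⟩ := Set.disjoint_union_right.1 hXE
  have hreflect : ∀ Q : Rect, Disjoint (Q.carrier vs vu) (-X) →
      Disjoint (Q.carrier vs vu) (E ∪ -E) →
      Disjoint ((Q.reflect vs vu).carrier vs vu) (X ∪ E) := by
    intro Q h₁ h₂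
    have := Rect.disjoint_reflect (h₁.union_right (h₂.mono_right Set.subset_union_right))
    rwa [Set.union_neg, neg_neg, neg_neg] at this
  refine ⟨X, -X, hX, hX.neg, hXX, hXE₁, ?_,
    ⟨R, hR, hRX.union_right (hRE.mono_right Set.subset_union_left)⟩,
    ⟨R', hR', hRX'.union_right (hRE'.mono_right Set.subset_union_left)⟩,
    ⟨R.reflect vs vu, hR.reflect, hreflect R hRX hRE⟩,
    ⟨R'.reflect vs vu, hR'.reflect, hreflect R' hRX' hRE'⟩⟩
  rw [Set.disjoint_left] at hXE₂ ⊢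
  exact fun v hv hvE => hXE₂ hv (by simpa using hvE)

end Paper
end

section
/- Let A be a 2×2 integer matrix with determinant 1 and trace > 2, let 𝒳 ⊆ 𝕋² be a nonempty finite f_A-invariant set, let x ∈ 𝒳̃, and let π ≥ 1 be the least period of the image of x in 𝕋² under f_A. Then the set B(x) = {ℓ^s(R) : R is a primitive positive (𝒳,x)-rectangle} ⊆ (0,∞) is nonempty, satisfies λ^π · B(x) = B(x), and its intersection with every compact interval [a,b] with 0 < a ≤ b is finite; consequently, for every t > 0 the set B(x) ∩ (0,t] has a maximum. -/
/- Common setup: following the paper, we identify each subset of the torus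
`𝕋² = ℝ²/ℤ²` with its (`ℤ²`-saturated) lift to `ℝ²`. -/

open Matrix Set
open scoped Pointwise

namespace Paper

/-- The coordinates, in the frame `(vs, vu)` centred at `x`, of the points of `X`. -/
def frameCoords (vs vu : V) (X : Set V) (x : V) : Set (ℝ × ℝ) :=
  {c | x + c.1 • vs + c.2 • vu ∈ X}

/-- Widths of the boxes `[0, s] × [0, u]` meeting `Y` only in two opposite corners. -/
def emptyBoxWidths (Y : Set (ℝ × ℝ)) : Set ℝ :=
  {s | 0 < s ∧ ∃ u, 0 < u ∧ (s, u) ∈ Y ∧ ∀ a b, (a, b) ∈ Y → 0 ≤ a → a ≤ s → 0 ≤ b → b ≤ u →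
    (a = 0 ∧ b = 0) ∨ (a = s ∧ b = u)}

section Planar

variable {Y : Set (ℝ × ℝ)}

lemma emptyBoxWidths_nonempty
    (hfin : ∀ r s : ℝ, (Y ∩ Icc 0 r ×ˢ Icc 0 s).Finite)
    (haxs : ∀ a, (a, 0) ∈ Y → a = 0) (haxu : ∀ b, (0, b) ∈ Y → b = 0)
    {s u : ℝ} (hs : 0 < s) (hu : 0 < u) (hsu : (s, u) ∈ Y) :
    (emptyBoxWidths Y).Nonempty := by
  have hfin' := (hfin s u).inter_of_left {c | 0 < c.1 ∧ 0 < c.2}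
  obtain ⟨⟨a, b⟩, ⟨⟨hab, ⟨ha0, has⟩, ⟨hb0, hbu⟩⟩, ha, hb⟩, hmin⟩ :=
    exists_min_image _ (fun c : ℝ × ℝ => c.1 + c.2) hfin'
      ⟨(s, u), ⟨hsu, ⟨hs.le, le_rfl⟩, ⟨hu.le, le_rfl⟩⟩, hs, hu⟩
  simp only at ha0 has hb0 hbu ha hb
  refine ⟨a, ha, b, hb, hab, fun a' b' h ha' haa hb' hbb => ?_⟩
  rcases ha'.eq_or_lt with rfl | ha'
  · exact Or.inl ⟨rfl, haxu _ h⟩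
  rcases hb'.eq_or_lt with rfl | hb'
  · exact Or.inl ⟨haxs _ h, rfl⟩
  have := hmin (a', b') ⟨⟨h, ⟨ha'.le, haa.trans has⟩, ⟨hb'.le, hbb.trans hbu⟩⟩, ha', hb'⟩
  simp only at this
  exact Or.inr ⟨by linarith, by linarith⟩

lemma mul_mem_emptyBoxWidths {μ : ℝ} (hμ : 0 < μ)
    (hY : ∀ a b, (μ * a, μ⁻¹ * b) ∈ Y ↔ (a, b) ∈ Y) {s : ℝ} :
    μ * s ∈ emptyBoxWidths Y ↔ s ∈ emptyBoxWidths Y := by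
  have hμ' := inv_pos.2 hμ
  constructor
  · rintro ⟨hs, u, hu, hsu, h⟩
    have hu' : μ⁻¹ * (μ * u) = u := by field_simp
    refine ⟨pos_of_mul_pos_right hs hμ.le, μ * u, by positivity, (hY _ _).1 (by rwa [hu']), ?_⟩
    intro a b hab ha has hb hbu
    rcases h _ _ ((hY _ _).2 hab) (by positivity) (by gcongr) (by positivity)
      (by rw [← hu']; gcongr) with ⟨h1, h2⟩ | ⟨h1, h2⟩
    · exact Or.inl ⟨by simpa [hμ.ne'] using h1, by simpa [hμ.ne'] using h2⟩
    · exact Or.inr ⟨mul_left_cancel₀ hμ.ne' h1, by rw [← h2]; field_simp⟩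
  · rintro ⟨hs, u, hu, hsu, h⟩
    refine ⟨by positivity, μ⁻¹ * u, by positivity, (hY _ _).2 hsu, fun a b hab ha has hb hbu => ?_⟩
    have ha' : μ * (μ⁻¹ * a) = a := by field_simp
    have hb' : μ⁻¹ * (μ * b) = b := by field_simp
    have hu' : μ * (μ⁻¹ * u) = u := by field_simp
    have hs' : μ⁻¹ * (μ * s) = s := by field_simp
    rcases h (μ⁻¹ * a) (μ * b) ((hY _ _).1 (by rwa [ha', hb'])) (by positivity)
      (by rw [← hs']; gcongr) (by positivity) (by rw [← hu']; gcongr) with ⟨h1, h2⟩ | ⟨h1, h2⟩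
    · exact Or.inl ⟨by simpa [hμ.ne'] using h1, by simpa [hμ.ne'] using h2⟩
    · exact Or.inr ⟨by rw [← h1, ha'], by rw [← h2, hb']⟩

lemma exists_mem_emptyBoxWidths_le {μ : ℝ} (hμ : 1 < μ)
    (hY : ∀ a b, (μ * a, μ⁻¹ * b) ∈ Y ↔ (a, b) ∈ Y) (hne : (emptyBoxWidths Y).Nonempty)
    {t : ℝ} (ht : 0 < t) : ∃ s ∈ emptyBoxWidths Y, s < t := by
  obtain ⟨s, hs⟩ := hne
  obtain ⟨n, hn⟩ := pow_unbounded_of_one_lt (s / t) hμ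
  have hμ0 : 0 < μ := one_pos.trans hμ
  have hmem : ∀ k : ℕ, (μ ^ k)⁻¹ * s ∈ emptyBoxWidths Y := by
    intro k
    induction k with
    | zero => simpa using hs
    | succ k ih =>
      rw [← mul_mem_emptyBoxWidths hμ0 hY]
      convert ih using 1
      field_simp
      ring
  refine ⟨_, hmem n, ?_⟩
  rw [div_lt_iff₀ ht] at hn
  rwa [inv_mul_lt_iff₀ (by positivity)]

lemma emptyBoxWidths_inter_Icc_finite {μ : ℝ} (hμ : 1 < μ)
    (hfin : ∀ r s : ℝ, (Y ∩ Icc 0 r ×ˢ Icc 0 s).Finite)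
    (hY : ∀ a b, (μ * a, μ⁻¹ * b) ∈ Y ↔ (a, b) ∈ Y) (hne : (emptyBoxWidths Y).Nonempty)
    {a b : ℝ} (ha : 0 < a) : (emptyBoxWidths Y ∩ Icc a b).Finite := by
  obtain ⟨s₁, ⟨hs₁, u₁, hu₁, hsu₁, -⟩, hlt⟩ := exists_mem_emptyBoxWidths_le hμ hY hne ha
  refine ((hfin b u₁).image Prod.fst).subset ?_
  rintro s ⟨⟨hs, u, hu, hsu, h⟩, has, hsb⟩
  refine ⟨(s, u), ⟨hsu, ⟨hs.le, hsb⟩, ⟨hu.le, ?_⟩⟩, rfl⟩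
  by_contra hlt'
  rcases h _ _ hsu₁ hs₁.le (by linarith) hu₁.le (by simp only [not_le] at hlt'; exact hlt'.le)
    with ⟨h1, -⟩ | ⟨h1, -⟩ <;> linarith

lemma emptyBoxWidths_exists_max {μ : ℝ} (hμ : 1 < μ)
    (hfin : ∀ r s : ℝ, (Y ∩ Icc 0 r ×ˢ Icc 0 s).Finite)
    (hY : ∀ a b, (μ * a, μ⁻¹ * b) ∈ Y ↔ (a, b) ∈ Y) (hne : (emptyBoxWidths Y).Nonempty)
    {t : ℝ} (ht : 0 < t) : ∃ m ∈ emptyBoxWidths Y ∩ Ioc 0 t,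
      ∀ y ∈ emptyBoxWidths Y ∩ Ioc 0 t, y ≤ m := by
  obtain ⟨s, hs, hst⟩ := exists_mem_emptyBoxWidths_le hμ hY hne ht
  obtain ⟨m, ⟨hm, hsm, hmt⟩, hmax⟩ := exists_max_image _ id
    (emptyBoxWidths_inter_Icc_finite (b := t) hμ hfin hY hne hs.1) ⟨s, hs, le_rfl, hst.le⟩
  refine ⟨m, ⟨hm, hm.1, hmt⟩, fun y hy => ?_⟩
  rcases le_total y s with h | h
  · exact h.trans hsm
  · exact hmax y ⟨hy.1, h, hy.2.2⟩

end Planar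

section Lattice

lemma lattice_add {v w : V} (hv : v ∈ lattice) (hw : w ∈ lattice) : v + w ∈ lattice := by
  obtain ⟨m, rfl⟩ := hv
  obtain ⟨n, rfl⟩ := hw
  exact ⟨m + n, by ext i; simp⟩

lemma lattice_neg {v : V} (hv : v ∈ lattice) : -v ∈ lattice := by
  obtain ⟨m, rfl⟩ := hv
  exact ⟨-m, by ext i; simp⟩

lemma IsTorusFinite.add_mem_iff {E : Set V} (hE : IsTorusFinite E) {v w : V}
    (hw : w ∈ lattice) : v + w ∈ E ↔ v ∈ E := by
  obtain ⟨F, -, rfl⟩ := hE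
  constructor
  · rintro ⟨f, hf, l, hl, h⟩
    refine ⟨f, hf, l + -w, lattice_add hl (lattice_neg hw), ?_⟩
    simp only at h ⊢
    rw [← add_assoc, h, add_neg_cancel_right]
  · rintro ⟨f, hf, l, hl, rfl⟩
    exact ⟨f, hf, l + w, lattice_add hl hw, (add_assoc _ _ _).symm⟩

lemma IsTorusFinite.sub {E : Set V} (hE : IsTorusFinite E) : IsTorusFinite (E - E) := by
  obtain ⟨F, hF, rfl⟩ := hE
  refine ⟨F - F, hF.sub hF, ?_⟩
  ext v
  constructor
  · rintro ⟨_, ⟨f, hf, l, hl, rfl⟩, _, ⟨g, hg, m, hm, rfl⟩, rfl⟩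
    exact ⟨f - g, ⟨f, hf, g, hg, rfl⟩, l + -m, lattice_add hl (lattice_neg hm), by
      simp only; abel⟩
  · rintro ⟨_, ⟨f, hf, g, hg, rfl⟩, l, hl, rfl⟩
    exact ⟨f + l, ⟨f, hf, l, hl, rfl⟩, g + 0, ⟨g, hg, 0, ⟨0, by ext i; simp⟩, rfl⟩, by
      simp only; abel⟩

lemma IsTorusFinite.inter_finite {E : Set V} (hE : IsTorusFinite E) (r : ℝ) :
    (E ∩ Metric.closedBall 0 r).Finite := by
  obtain ⟨F, hF, rfl⟩ := hE
  have : ∀ f ∈ F, (((fun m : Fin 2 → ℤ => f + fun i => (m i : ℝ)) '' univ) ∩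
      Metric.closedBall 0 r).Finite := by
    intro f _
    refine ((Set.finite_Icc (fun i => ⌊-r - f i⌋) (fun i => ⌈r - f i⌉)).image
      (fun m : Fin 2 → ℤ => f + fun i => (m i : ℝ))).subset ?_
    rintro _ ⟨⟨m, -, rfl⟩, hm⟩
    refine ⟨m, ⟨fun i => ?_, fun i => ?_⟩, rfl⟩
    all_goals
      have h1 := (norm_le_pi_norm (f + fun i => (m i : ℝ)) i).trans (mem_closedBall_zero_iff.1 hm)
      simp only [Pi.add_apply, Real.norm_eq_abs, abs_le] at h1
    · have := Int.floor_le (-r - f i)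
      exact_mod_cast (by linarith : (⌊-r - f i⌋ : ℝ) ≤ m i)
    · have := Int.le_ceil (r - f i)
      exact_mod_cast (by linarith : (m i : ℝ) ≤ ⌈r - f i⌉)
  refine (hF.biUnion this).subset ?_
  rintro _ ⟨⟨f, hf, _, ⟨m, rfl⟩, rfl⟩, hb⟩
  exact mem_biUnion hf ⟨⟨m, mem_univ _, rfl⟩, hb⟩

end Lattice

section Action

variable {A : Matrix (Fin 2) (Fin 2) ℤ} {vs vu : V} {lam : ℝ}

lemma actR_add (v w : V) : actR A (v + w) = actR A v + actR A w := mulVec_add _ _ _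

lemma actR_sub (v w : V) : actR A (v - w) = actR A v - actR A w := mulVec_sub _ _ _

lemma actR_smul (c : ℝ) (v : V) : actR A (c • v) = c • actR A v := mulVec_smul _ _ _

lemma actR_injective (hdet : A.det = 1) : Function.Injective (actR A) := by
  apply mulVec_injective_of_isUnit
  rw [isUnit_iff_isUnit_det]
  have : (A.map (Int.cast : ℤ → ℝ)).det = ((A.det : ℤ) : ℝ) := (Int.cast_det A).symm
  simp [this, hdet]

lemma IsInvariant.actR_mem_iff {E : Set V} (hE : IsInvariant A E) (hdet : A.det = 1) {v : V} :
    actR A v ∈ E ↔ v ∈ E := by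
  conv_lhs => rw [← hE]
  exact (actR_injective hdet).mem_set_image

lemma IsInvariant.iterate_mem_iff {E : Set V} (hE : IsInvariant A E) (hdet : A.det = 1) (n : ℕ)
    {v : V} : (actR A)^[n] v ∈ E ↔ v ∈ E := by
  induction n with
  | zero => rfl
  | succ n ih => rw [Function.iterate_succ_apply', hE.actR_mem_iff hdet, ih]

lemma IsInvariant.sub {E : Set V} (hE : IsInvariant A E) : IsInvariant A (E - E) := by
  have h : actR A '' (E - E) = actR A '' E - actR A '' E :=
    image_image2_distrib actR_sub
  rw [IsInvariant, h, hE]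

lemma iterate_actR_frame (hAs : actR A vs = lam⁻¹ • vs) (hAu : actR A vu = lam • vu)
    (n : ℕ) (y : V) (a b : ℝ) :
    (actR A)^[n] (y + a • vs + b • vu) =
      (actR A)^[n] y + ((lam ^ n)⁻¹ * a) • vs + (lam ^ n * b) • vu := by
  induction n with
  | zero => simp
  | succ n ih =>
    simp only [Function.iterate_succ_apply', ih, actR_add, actR_smul, hAs, hAu, smul_smul]
    congr 1
    · congr 2
      ring
    · congr 1
      ring

lemma frame_independent (hlam : 1 < lam) (hvs : vs ≠ 0) (hvu : vu ≠ 0)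
    (hAs : actR A vs = lam⁻¹ • vs) (hAu : actR A vu = lam • vu) {a b : ℝ}
    (h : a • vs + b • vu = 0) : a = 0 ∧ b = 0 := by
  have h1 : (lam⁻¹ * a) • vs + (lam * b) • vu = 0 := by
    have := congrArg (actR A) h
    rw [actR_add, actR_smul, actR_smul, hAs, hAu, smul_smul, smul_smul] at this
    rw [mul_comm lam⁻¹, mul_comm lam, this]
    exact mulVec_zero _
  have h2 : ((lam - lam⁻¹) * b) • vu = 0 := by
    have : ((lam - lam⁻¹) * b) • vu =
      ((lam⁻¹ * a) • vs + (lam * b) • vu) - lam⁻¹ • (a • vs + b • vu) := by module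
    rw [this, h1, h, smul_zero, sub_zero]
  have h3 : lam⁻¹ < 1 := inv_lt_one_of_one_lt₀ hlam
  have hb : b = 0 := by
    rcases smul_eq_zero.1 h2 with h | h
    · exact (mul_eq_zero.1 h).resolve_left (by linarith)
    · exact absurd h hvu
  subst hb
  simp only [zero_smul, add_zero] at h
  exact ⟨(smul_eq_zero.1 h).resolve_right hvs, rfl⟩

lemma exists_lattice_in_open_cone
    (hind : ∀ a b : ℝ, a • vs + b • vu = 0 → a = 0 ∧ b = 0) :
    ∃ a b : ℝ, 0 < a ∧ 0 < b ∧ a • vs + b • vu ∈ lattice := by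
  have hd : vs 0 * vu 1 - vs 1 * vu 0 ≠ 0 := by
    intro hd
    have h1 := hind (vu 1) (-vs 1) (by
      ext i; fin_cases i <;> simp <;> linarith)
    have h0 := hind (vu 0) (-vs 0) (by
      ext i; fin_cases i <;> simp <;> linarith)
    have := hind 1 0 (by ext i; fin_cases i <;> simp <;> linarith)
    exact one_ne_zero this.1
  set d := vs 0 * vu 1 - vs 1 * vu 0 with hd_def
  have key : ∀ e p : ℝ, 0 ≤ e → e < 1 → |e * p| ≤ |p| := by
    intro e p h0 h1
    rw [abs_mul, abs_of_nonneg h0]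
    exact mul_le_of_le_one_left (abs_nonneg _) h1.le
  set t := |vs 0 / d| + |vs 1 / d| + |vu 0 / d| + |vu 1 / d| + 1 with ht
  set w := t • (vs + vu) with hw
  have f0 := Int.fract_nonneg (w 0)
  have f1 := Int.fract_nonneg (w 1)
  have g0 := Int.fract_lt_one (w 0)
  have g1 := Int.fract_lt_one (w 1)
  have e0 := Int.self_sub_fract (w 0)
  have e1 := Int.self_sub_fract (w 1)
  refine ⟨t - Int.fract (w 0) * (vu 1 / d) + Int.fract (w 1) * (vu 0 / d),
    t + Int.fract (w 0) * (vs 1 / d) - Int.fract (w 1) * (vs 0 / d), ?_, ?_,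
    fun i => ⌊w i⌋, ?_⟩
  · have h1 := abs_le.1 (key _ (vu 1 / d) f0 g0)
    have h2 := abs_le.1 (key _ (vu 0 / d) f1 g1)
    have := abs_nonneg (vs 0 / d)
    have := abs_nonneg (vs 1 / d)
    linarith
  · have h1 := abs_le.1 (key _ (vs 1 / d) f0 g0)
    have h2 := abs_le.1 (key _ (vs 0 / d) f1 g1)
    have := abs_nonneg (vu 0 / d)
    have := abs_nonneg (vu 1 / d)
    linarith
  · have w0 : w 0 = t * (vs 0 + vu 0) := rfl
    have w1 : w 1 = t * (vs 1 + vu 1) := rfl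
    have hdd : (vs 0 * vu 1 - vs 1 * vu 0) / d = 1 := div_self hd
    ext i
    fin_cases i
    · simp only [Fin.zero_eta, Fin.isValue, ← e0, Pi.add_apply, Pi.smul_apply, smul_eq_mul]
      linear_combination w0 - Int.fract (w 0) * (-hdd)
    · simp only [Fin.mk_one, Fin.isValue, ← e1, Pi.add_apply, Pi.smul_apply, smul_eq_mul]
      linear_combination w1 - Int.fract (w 1) * (-hdd)

/-- A locally finite set contains no sequence contracting to the origin along a line. -/
lemma eq_zero_of_contracted_mem {D : Set V} (hD : IsTorusFinite D) {v : V} (hv : v ≠ 0)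
    (hlam : 1 < lam) {a : ℝ} (h : ∀ n : ℕ, ((lam⁻¹) ^ n * a) • v ∈ D) : a = 0 := by
  by_contra ha
  have h0 : 0 < lam⁻¹ := inv_pos.2 (by linarith)
  have h1 : lam⁻¹ < 1 := inv_lt_one_of_one_lt₀ hlam
  refine Set.infinite_range_of_injective (f := fun n : ℕ => (lam⁻¹ ^ n * a) • v) ?_
    ((hD.inter_finite ‖a • v‖).subset ?_)
  · intro m n hmn
    exact (pow_right_strictAnti₀ h0 h1).injective
      (mul_right_cancel₀ ha (smul_left_injective ℝ hv hmn))
  · rintro _ ⟨n, rfl⟩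
    refine ⟨h n, mem_closedBall_zero_iff.2 ?_⟩
    simp only [mul_smul]
    rw [norm_smul, Real.norm_of_nonneg (by positivity)]
    exact mul_le_of_le_one_left (norm_nonneg _) (pow_le_one₀ h0.le h1.le)

lemma stable_coord_eq_zero {D : Set V} (hD : IsTorusFinite D) (hDinv : IsInvariant A D)
    (hdet : A.det = 1) (hlam : 1 < lam) (hvs : vs ≠ 0) (hAs : actR A vs = lam⁻¹ • vs)
    {a : ℝ} (h : a • vs ∈ D) : a = 0 := by
  refine eq_zero_of_contracted_mem hD hvs hlam fun n => ?_
  induction n with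
  | zero => simpa using h
  | succ n ih =>
    rw [← hDinv.actR_mem_iff hdet, actR_smul, hAs, smul_smul] at ih
    convert ih using 2
    ring

lemma unstable_coord_eq_zero {D : Set V} (hD : IsTorusFinite D) (hDinv : IsInvariant A D)
    (hdet : A.det = 1) (hlam : 1 < lam) (hvu : vu ≠ 0) (hAu : actR A vu = lam • vu)
    {b : ℝ} (h : b • vu ∈ D) : b = 0 := by
  refine eq_zero_of_contracted_mem hD hvu hlam fun n => ?_
  induction n with
  | zero => simpa using h
  | succ n ih =>
    rw [← hDinv.actR_mem_iff hdet, actR_smul, hAu, smul_smul]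
    convert ih using 2
    have : lam * lam⁻¹ = 1 := mul_inv_cancel₀ (by linarith)
    linear_combination lam⁻¹ ^ n * b * this

end Action

section Frame

variable {vs vu : V} {X : Set V} {x : V}

lemma frameCoords_inter_finite (hX : IsTorusFinite X)
    (hind : ∀ a b : ℝ, a • vs + b • vu = 0 → a = 0 ∧ b = 0) (r s : ℝ) :
    (frameCoords vs vu X x ∩ Icc 0 r ×ˢ Icc 0 s).Finite := by
  refine Set.Finite.of_finite_image (f := fun c : ℝ × ℝ => x + c.1 • vs + c.2 • vu)
    ((hX.inter_finite (‖x‖ + r * ‖vs‖ + s * ‖vu‖)).subset ?_) ?_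
  · rintro _ ⟨⟨a, b⟩, ⟨h, ⟨ha, har⟩, ⟨hb, hbs⟩⟩, rfl⟩
    refine ⟨h, mem_closedBall_zero_iff.2 ?_⟩
    simp only at ha har hb hbs ⊢
    refine (norm_add₃_le).trans ?_
    rw [norm_smul, norm_smul, Real.norm_of_nonneg ha, Real.norm_of_nonneg hb]
    gcongr
  · rintro ⟨a, b⟩ - ⟨a', b'⟩ - h
    simp only at h
    have := hind (a - a') (b - b') (by rw [← sub_eq_zero] at h; rw [← h]; module)
    exact Prod.ext (sub_eq_zero.1 this.1) (sub_eq_zero.1 this.2)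

lemma baseLengths_eq_emptyBoxWidths (hx : x ∈ X)
    (hind : ∀ a b : ℝ, a • vs + b • vu = 0 → a = 0 ∧ b = 0) :
    baseLengths vs vu X x = emptyBoxWidths (frameCoords vs vu X x) := by
  ext s
  constructor
  · rintro ⟨⟨p, s, u, hs, hu⟩, ⟨⟨-, hend⟩, hprim⟩, rfl, rfl⟩
    refine ⟨hs, u, hu, hend, fun a b hab ha has hb hbu => ?_⟩
    have hmem : p + a • vs + b • vu ∈ ({p, p + s • vs + u • vu} : Set V) :=
      hprim.subset ⟨⟨a, b, ha, has, hb, hbu, rfl⟩, hab⟩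
    rcases hmem with h | h
    · exact Or.inl (hind a b (by rwa [add_assoc, add_eq_left] at h))
    · rw [mem_singleton_iff, add_assoc, add_assoc, add_right_inj] at h
      have := hind (a - s) (b - u) (by rw [← sub_eq_zero] at h; rw [← h]; module)
      exact Or.inr ⟨sub_eq_zero.1 this.1, sub_eq_zero.1 this.2⟩
  · rintro ⟨hs, u, hu, hsu, h⟩
    refine ⟨⟨x, s, u, hs, hu⟩, ⟨⟨hx, hsu⟩, Subset.antisymm ?_ ?_⟩, rfl, rfl⟩
    · rintro _ ⟨⟨a, b, ha, has, hb, hbu, rfl⟩, hab⟩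
      rcases h a b hab ha has hb hbu with ⟨rfl, rfl⟩ | ⟨rfl, rfl⟩
      · exact Or.inl (by simp)
      · exact Or.inr rfl
    · rintro _ (rfl | rfl)
      · exact ⟨⟨0, 0, le_rfl, hs.le, le_rfl, hu.le, by simp⟩, hx⟩
      · exact ⟨⟨s, u, hs.le, le_rfl, hu.le, le_rfl, rfl⟩, hsu⟩

end Frame

/-- properties of the set `B(x)` of stable side lengths of the
primitive positive `(𝒳,x)`-rectangles, where `per` is the least period of the
image of `x` in the torus: `B(x) ⊆ (0,∞)` is nonempty, `λ^per`-invariant, has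
finite intersection with every compact interval `[a,b] ⊆ (0,∞)`, and
`B(x) ∩ (0,t]` has a maximum for every `t > 0`. -/
theorem statement_9 (A : Matrix (Fin 2) (Fin 2) ℤ) (hdet : A.det = 1) (htr : 2 < A.trace)
    (lam : ℝ) (hlam : 1 < lam) (vs vu : V) (hvs : vs ≠ 0) (hvu : vu ≠ 0)
    (hAs : actR A vs = lam⁻¹ • vs) (hAu : actR A vu = lam • vu)
    (X : Set V) (hXne : X.Nonempty) (hXfin : IsTorusFinite X) (hXinv : IsInvariant A X)
    (x : V) (hx : x ∈ X) (per : ℕ) (hper1 : 1 ≤ per)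
    (hper : (actR A)^[per] x - x ∈ lattice)
    (hleast : ∀ q : ℕ, 0 < q → q < per → (actR A)^[q] x - x ∉ lattice) :
    (baseLengths vs vu X x).Nonempty ∧
    baseLengths vs vu X x ⊆ Set.Ioi (0 : ℝ) ∧
    (fun t => lam ^ per * t) '' baseLengths vs vu X x = baseLengths vs vu X x ∧
    (∀ a b : ℝ, 0 < a → a ≤ b → (baseLengths vs vu X x ∩ Set.Icc a b).Finite) ∧
    ∀ t : ℝ, 0 < t → ∃ m ∈ baseLengths vs vu X x ∩ Set.Ioc 0 t,
      ∀ y ∈ baseLengths vs vu X x ∩ Set.Ioc 0 t, y ≤ m := by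
  have hind : ∀ a b : ℝ, a • vs + b • vu = 0 → a = 0 ∧ b = 0 := fun a b =>
    frame_independent hlam hvs hvu hAs hAu
  rw [baseLengths_eq_emptyBoxWidths hx hind]
  set Y := frameCoords vs vu X x with hYdef
  have hfin : ∀ r s : ℝ, (Y ∩ Icc 0 r ×ˢ Icc 0 s).Finite :=
    frameCoords_inter_finite hXfin hind
  have haxs : ∀ a, (a, 0) ∈ Y → a = 0 := fun a ha =>
    stable_coord_eq_zero hXfin.sub hXinv.sub hdet hlam hvs hAs ⟨_, ha, x, hx, by simp⟩
  have haxu : ∀ b, (0, b) ∈ Y → b = 0 := fun b hb =>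
    unstable_coord_eq_zero hXfin.sub hXinv.sub hdet hlam hvu hAu ⟨_, hb, x, hx, by simp⟩
  have hμ : 1 < lam ^ per := one_lt_pow₀ hlam (by omega)
  have hμ0 : 0 < lam ^ per := one_pos.trans hμ
  have hY : ∀ a b, (lam ^ per * a, (lam ^ per)⁻¹ * b) ∈ Y ↔ (a, b) ∈ Y := by
    intro a b
    change x + (lam ^ per * a) • vs + ((lam ^ per)⁻¹ * b) • vu ∈ X ↔ x + a • vs + b • vu ∈ X
    rw [← hXinv.iterate_mem_iff hdet per, iterate_actR_frame hAs hAu,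
      inv_mul_cancel_left₀ hμ0.ne', mul_inv_cancel_left₀ hμ0.ne',
      ← hXfin.add_mem_iff (v := x + a • vs + b • vu) hper]
    congr! 1
    abel
  obtain ⟨a, b, ha, hb, hab⟩ := exists_lattice_in_open_cone hind
  have hne : (emptyBoxWidths Y).Nonempty := by
    refine emptyBoxWidths_nonempty hfin haxs haxu ha hb ?_
    change x + a • vs + b • vu ∈ X
    rwa [add_assoc, hXfin.add_mem_iff hab]
  refine ⟨hne, fun s hs => hs.1, ?_,
    fun a b ha _ => emptyBoxWidths_inter_Icc_finite hμ hfin hY hne ha,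
    fun t ht => emptyBoxWidths_exists_max hμ hfin hY hne ht⟩
  ext s
  constructor
  · rintro ⟨s, hs, rfl⟩
    exact (mul_mem_emptyBoxWidths hμ0 hY).2 hs
  · intro hs
    have h : lam ^ per * ((lam ^ per)⁻¹ * s) = s := mul_inv_cancel_left₀ hμ0.ne' s
    exact ⟨_, (mul_mem_emptyBoxWidths hμ0 hY).1 (h.symm ▸ hs), h⟩

end Paper
end
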